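/- arXiv:1901.07644 — 2 statements merged into one kernel-verified Lean document; each statement's English description precedes it below -/
import Mathlib

section
/- Let f:D₁→D₂ be a finite étale morphism of open unit discs of degree d. Then f is radial if and only if there exists a function N:[0,1)→ℕ such that for every rational point y∈D₂(k) and every ρ∈[0,1) one has #f^{-1}(ζ_{y,ρ})=N(ρ), where #f^{-1} counts preimages without multiplicity. Moreover, when f is radial, the profile p_f is uniquely determined by the function N. -/
/-!
Throughout, `k` is a complete, nonarchimedean, nontrivially valued, algebraically closed
field extension of `ℚ_p`, and `v = -log ‖·‖`.
-/

open Set Filter Topology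

noncomputable section

/-- The set of `k`-rational points of the standard open unit disc over `k`. -/
abbrev UnitDisc (k : Type*) [NormedField k] := {a : k // ‖a‖ < 1}

variable (k : Type*) [NontriviallyNormedField k]

/-- A finite morphism `f : D₁ → D₂` of open unit discs over `k`, recorded via its action on
`k`-rational points together with, for every center `a ∈ D₁(k)`, the coefficients
`coeff a i = f^{[i]}(a)` of its power-series expansion with respect to any pair of compatible
coordinates centered at `a` and at `f a`; `degree` is the degree of `f`, i.e. the number of
preimages of any rational point of `D₂`, counted with multiplicities (the multiplicity of `f`
at `b` being the order of vanishing `min {i ≥ 1 : f^{[i]}(b) ≠ 0}` of `f - f(b)` at `b`). -/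
structure DiscMorphism where
  /-- the action of `f` on `k`-rational points -/
  toFun : UnitDisc k → UnitDisc k
  /-- `coeff a i = f^{[i]}(a)`, the `i`-th divided derivative of `f` at `a` -/
  coeff : UnitDisc k → ℕ → k
  coeff_zero : ∀ a, coeff a 0 = 0
  coeff_nonconst : ∀ a, ∃ i, 1 ≤ i ∧ coeff a i ≠ 0
  /-- the power-series expansion of `f` at `a` converges on `D₁` and computes `f` -/
  expansion : ∀ a b : UnitDisc k,
    HasSum (fun i : ℕ => coeff a i * ((b : k) - (a : k)) ^ i) ((toFun b : k) - (toFun a : k))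
  /-- the degree of the finite morphism `f` -/
  degree : ℕ
  degree_pos : 0 < degree
  /-- every rational point of `D₂` has exactly `degree` preimages counted with multiplicity -/
  finite_fibers : ∀ c : UnitDisc k, ∃ s : Finset (UnitDisc k),
    (∀ b, toFun b = c ↔ b ∈ s) ∧
    (s.sum fun b => sInf {i | 1 ≤ i ∧ coeff b i ≠ 0}) = degree

variable {k}

/-- The closed disc `D(b,s)` (its set of `k`-rational points). -/
def closedDisc (b : k) (s : ℝ) : Set k := {x | ‖x - b‖ ≤ s}

/-- The open disc `D(b,s⁻)` (its set of `k`-rational points). -/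
def openDisc (b : k) (s : ℝ) : Set k := {x | ‖x - b‖ < s}

/-- The right slope `∂⁺g(x)` of a (piecewise affine) function `g` at `x`. -/
def rightSlope (g : ℝ → ℝ) (x : ℝ) : ℝ := derivWithin g (Set.Ioi x) x

/-- The left slope `∂⁻g(x)` of a (piecewise affine) function `g` at `x`. -/
def leftSlope (g : ℝ → ℝ) (x : ℝ) : ℝ := derivWithin g (Set.Iio x) x

/-- The set of slopes of a (piecewise affine, concave) function `g` on a set `s`. -/
def slopesOn (g : ℝ → ℝ) (s : Set ℝ) : Set ℝ := rightSlope g '' s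

/-- The set of jumps (points of discontinuity) of a function `N : [0,1) → ℕ`. -/
def jumpSet (N : ℝ → ℕ) : Set ℝ :=
  {ρ | ρ ∈ Set.Ico (0:ℝ) 1 ∧ ¬ContinuousWithinAt N (Set.Ico (0:ℝ) 1) ρ}

namespace DiscMorphism

variable (F : DiscMorphism k)

/-- The multiplicity of `f` at a rational point `b ∈ D₁(k)`, i.e. the order of vanishing of
`f - f(b)` at `b`. -/
def mult (b : UnitDisc k) : ℕ := sInf {i | 1 ≤ i ∧ F.coeff b i ≠ 0}

/-- `f` is étale iff its derivative `f^{[1]}` vanishes nowhere on `D₁`. -/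
def Etale : Prop := ∀ a : UnitDisc k, F.coeff a 1 ≠ 0

/-- The valuation polygon `v_a(f,·)` of `f` at the rational point `a ∈ D₁(k)`:
`v_a(f,λ) = inf_i { v(f^{[i]}(a)) + i·λ }`. -/
def vpol (a : UnitDisc k) (lam : ℝ) : ℝ :=
  sInf {t : ℝ | ∃ i : ℕ, F.coeff a i ≠ 0 ∧ t = -Real.log ‖F.coeff a i‖ + i * lam}

/-- `f` is radial if its valuation polygon at `a` does not depend on `a ∈ D₁(k)`. -/
def Radial : Prop :=
  ∀ a b : UnitDisc k, ∀ lam : ℝ, 0 < lam → F.vpol a lam = F.vpol b lam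

/-- The profile `𝕡_{a,f}` of `f` at `a`, characterized by `𝕡_{a,f}(0) = 0`, `𝕡_{a,f}(1) = 1`
and `v_a(f, -log ρ) = -log 𝕡_{a,f}(ρ)` for `ρ ∈ (0,1)`, i.e. `f(D(a,ρ)) = D(f(a), 𝕡_{a,f}(ρ))`. -/
def profile (a : UnitDisc k) (ρ : ℝ) : ℝ :=
  if ρ ≤ 0 then 0 else if 1 ≤ ρ then 1 else Real.exp (-(F.vpol a (-Real.log ρ)))

/-- `N_x(ρ) = #f⁻¹(ζ_{x,ρ})`, the number of preimages of the point `ζ_{x,ρ}` counted without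
multiplicity: the preimages of `ζ_{x,ρ}` are the points `ζ_{b,s}` with
`f(ζ_{b,s}) = ζ_{f(b), 𝕡_{b,f}(s)} = ζ_{x,ρ}`, and two such points coincide exactly when the
corresponding closed discs `D(b,s)(k)` coincide. -/
def fiberCount (x : UnitDisc k) (ρ : ℝ) : ℕ :=
  Set.ncard {D : Set k | ∃ (b : UnitDisc k) (s : ℝ), 0 ≤ s ∧ s < 1 ∧
    F.profile b s = ρ ∧ ‖(F.toFun b : k) - (x : k)‖ ≤ ρ ∧ D = closedDisc (b : k) s}

/-- `f` is `n`-radial (`n ≥ 1`) if there is `r ∈ (0,1)` such that the valuation polygon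
`v_a(f,·)` restricted to `(0, -log r)` does not depend on `a ∈ D₁(k)` and has exactly `n`
slopes there; `0`-radial means finite. -/
def NRadial (n : ℕ) : Prop :=
  n = 0 ∨ ∃ r ∈ Set.Ioo (0:ℝ) 1,
    (∀ a b : UnitDisc k, Set.EqOn (F.vpol a) (F.vpol b) (Set.Ioo 0 (-Real.log r))) ∧
    ∀ a : UnitDisc k, (slopesOn (F.vpol a) (Set.Ioo 0 (-Real.log r))).ncard = n

/-- `f` is weakly `m`-radial, with set of first `m` slopes `s`: `f` is `(m-1)`-radial and,
for each `a ∈ D₁(k)`, the `m` largest slopes of `v_a(f,·)` are exactly the elements of `s`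
(in particular they do not depend on `a`). -/
def WeaklyRadialWith (m : ℕ) (s : Finset ℕ) : Prop :=
  F.NRadial (m - 1) ∧ s.card = m ∧
    ∀ a : UnitDisc k,
      (∀ j ∈ s, (j : ℝ) ∈ slopesOn (F.vpol a) (Set.Ioi 0)) ∧
      ∀ x ∈ slopesOn (F.vpol a) (Set.Ioi 0), (∃ j ∈ s, (j : ℝ) ≤ x) → ∃ j ∈ s, x = (j : ℝ)

/-- `f` is weakly `m`-radial. -/
def WeaklyRadial (m : ℕ) : Prop := ∃ s : Finset ℕ, F.WeaklyRadialWith m s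

/-- The exact `n`-boundary function `θ_n`, relative to the smallest dominating slope `iN = i_n`:
`θ_n(a) = min {ρ ∈ [0,1) : max_i ‖f^{[i]}(a)‖ρ^i = ‖f^{[i_n]}‖ρ^{i_n}}`, so that `-log θ_n(a)`
is the `n`-th break of `v_a(f,·)` (and `θ_n(a) = 0` when `i_n = 1`). -/
def theta (iN : ℕ) (a : UnitDisc k) : ℝ :=
  sInf {ρ : ℝ | 0 ≤ ρ ∧ ρ < 1 ∧
    (⨆ i : ℕ, ‖F.coeff a i‖ * ρ ^ i) = ‖F.coeff a iN‖ * ρ ^ iN}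

/-- `i_{n+1}(a)`: the smallest index `i` with `‖f^{[i]}(a)‖θ_n(a)^i = ‖f^{[i_n]}‖θ_n(a)^{i_n}`,
i.e. the slope of `v_a(f,·)` immediately after its `n`-th break. -/
def nextSlope (iN : ℕ) (a : UnitDisc k) : ℕ :=
  sInf {i : ℕ | 1 ≤ i ∧
    ‖F.coeff a i‖ * F.theta iN a ^ i = ‖F.coeff a iN‖ * F.theta iN a ^ iN}

/-- The `ρ`-Gauss norm `|f^{[i]}|_ρ` of the divided derivative `f^{[i]}`, i.e. the sup of
`‖f^{[i]}(a)‖` over the rational points of the closed disc `D(0,ρ)`. -/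
def gaussNorm (i : ℕ) (ρ : ℝ) : ℝ :=
  ⨆ b : {b : UnitDisc k // ‖(b.1 : k)‖ ≤ ρ}, ‖F.coeff b.1 i‖

/-- The number of connected components of `f⁻¹(D(x,s⁻))`: they are the open discs `D(b,t⁻)`
around preimages `b` of points of `D(x,s⁻)` with `f(D(b,t)) = D(f(b),s)`. -/
def compCount (x : UnitDisc k) (s : ℝ) : ℕ :=
  Set.ncard {D : Set k | ∃ (b : UnitDisc k) (t : ℝ), 0 ≤ t ∧ t ≤ 1 ∧
    ‖(F.toFun b : k) - (x : k)‖ < s ∧ F.profile b t = s ∧ D = openDisc (b : k) t}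

/-- The `i`-th radius of convergence `R_i` at `x ∈ D₂(k)` of the pushforward `f_*(𝒪_{D₁},d)`
of the constant differential equation:
`R_i = sup {s ∈ (0,1) : dim_k H⁰(f⁻¹(D(x,s⁻)), (𝒪,d)) ≥ d - i + 1}`, where the dimension of
the space of horizontal sections of the constant equation over `f⁻¹(D(x,s⁻))` equals the
number of connected components of `f⁻¹(D(x,s⁻))`. -/
def pushRadius (x : UnitDisc k) (i : ℕ) : ℝ :=
  sSup {s : ℝ | 0 < s ∧ s < 1 ∧ F.degree - i + 1 ≤ F.compCount x s}

end DiscMorphism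

namespace NonarchSeries

/-- `n` is the largest index at which `‖c i‖ * r ^ i` attains its maximum. -/
structure IsDominant (c : ℕ → k) (r : ℝ) (n : ℕ) : Prop where
  ne_zero : c n ≠ 0
  le : ∀ i, ‖c i‖ * r ^ i ≤ ‖c n‖ * r ^ n
  lt : ∀ i, n < i → ‖c i‖ * r ^ i < ‖c n‖ * r ^ n

/-- The power series with coefficients `c` converges on the closed disc of radius `r`. -/
def ConvergesOn (c : ℕ → k) (r : ℝ) : Prop :=
  Tendsto (fun i => ‖c i‖ * r ^ i) atTop (𝓝 0)

/-- The value at `x` of the power series with coefficients `c`. -/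
def eval (c : ℕ → k) (x : k) : k := ∑' i, c i * x ^ i

theorem IsDominant.unique {c : ℕ → k} {r : ℝ} {m n : ℕ} (hm : IsDominant c r m)
    (hn : IsDominant c r n) : m = n := by
  rcases lt_trichotomy m n with h | h | h
  · exact absurd (hm.lt n h) (not_lt.2 (hn.le m))
  · exact h
  · exact absurd (hn.lt m h) (not_lt.2 (hm.le n))

theorem exists_isDominant {c : ℕ → k} {r : ℝ} (hr : 0 < r) (hc : ConvergesOn c r)
    (h0 : ∃ i, c i ≠ 0) : ∃ n, IsDominant c r n := by
  classical
  obtain ⟨i₀, hi₀⟩ := h0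
  have hpos : 0 < ‖c i₀‖ * r ^ i₀ := mul_pos (norm_pos_iff.2 hi₀) (pow_pos hr _)
  obtain ⟨N, hN⟩ := eventually_atTop.1 ((tendsto_order.1 hc).2 _ hpos)
  have hi₀N : i₀ ∈ Finset.range (N + i₀ + 1) := by simp
  obtain ⟨m, hm, hmax⟩ := Finset.exists_max_image (Finset.range (N + i₀ + 1))
    (fun i => ‖c i‖ * r ^ i) ⟨i₀, hi₀N⟩
  have hle : ∀ i, ‖c i‖ * r ^ i ≤ ‖c m‖ * r ^ m := by
    intro i
    by_cases hi : i ∈ Finset.range (N + i₀ + 1)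
    · exact hmax i hi
    · refine (hN i ?_).le.trans (hmax i₀ hi₀N)
      simp at hi; omega
  have hmpos : 0 < ‖c m‖ * r ^ m := hpos.trans_le (hle i₀)
  obtain ⟨N', hN'⟩ := eventually_atTop.1 ((tendsto_order.1 hc).2 _ hmpos)
  let P : ℕ → Prop := fun i => ‖c i‖ * r ^ i = ‖c m‖ * r ^ m
  have hbd : ∀ i, P i → i ≤ N' := by
    intro i hi
    by_contra h
    exact absurd hi (hN' i (by omega)).ne
  have hPm : P m := rfl
  have hg := Nat.findGreatest_spec (P := P) (hbd m hPm) hPm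
  refine ⟨Nat.findGreatest P N', ?_, fun i => (hle i).trans_eq hg.symm, fun i hi => ?_⟩
  · intro h
    have : (0 : ℝ) = ‖c m‖ * r ^ m := by
      rw [← hg, h]; simp
    exact hmpos.ne this
  · refine lt_of_le_of_ne ((hle i).trans_eq hg.symm) fun h => ?_
    have hPi : P i := h.trans hg
    exact absurd (Nat.le_findGreatest (hbd i hPi) hPi) (not_le.2 hi)

theorem norm_term_le {r : ℝ} {x : k} (hx : ‖x‖ ≤ r) (a : k) (i : ℕ) :
    ‖a * x ^ i‖ ≤ ‖a‖ * r ^ i := by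
  rw [norm_mul, norm_pow]
  gcongr

theorem exists_bound {c : ℕ → k} {r : ℝ} (hc : ConvergesOn c r) :
    ∃ K, ∀ i, ‖c i‖ * r ^ i ≤ K := by
  obtain ⟨K, hK⟩ := hc.bddAbove_range
  exact ⟨K, fun i => hK ⟨i, rfl⟩⟩

theorem exists_lt_bound {c : ℕ → k} {r K : ℝ} (hc : ConvergesOn c r) {m : ℕ} (hK0 : 0 < K)
    (hK : ∀ i, m ≤ i → ‖c i‖ * r ^ i < K) : ∃ K' < K, 0 ≤ K' ∧ ∀ i, m ≤ i → ‖c i‖ * r ^ i ≤ K' := by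
  obtain ⟨N, hN⟩ := eventually_atTop.1 ((tendsto_order.1 hc).2 (K / 2) (by linarith))
  have hne : (insert (K / 2) ((Finset.Ico m N).image fun i => ‖c i‖ * r ^ i)).Nonempty := by simp
  refine ⟨_, (Finset.max'_lt_iff _ hne).2 ?_, ?_, fun i hi => ?_⟩
  · intro y hy
    simp only [Finset.mem_insert, Finset.mem_image, Finset.mem_Ico] at hy
    rcases hy with rfl | ⟨i, hi, rfl⟩
    · linarith
    · exact hK i hi.1
  · exact (by linarith : (0 : ℝ) ≤ K / 2).trans (Finset.le_max' _ _ (by simp))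
  · by_cases h : i < N
    · apply Finset.le_max'
      simp only [Finset.mem_insert, Finset.mem_image, Finset.mem_Ico]
      exact Or.inr ⟨i, ⟨hi, h⟩, rfl⟩
    · exact (hN i (by omega)).le.trans (Finset.le_max' _ _ (by simp))

theorem convergesOn_succ {c : ℕ → k} {r : ℝ} (hr : 0 < r) (hc : ConvergesOn c r) :
    ConvergesOn (fun i => c (i + 1)) r := by
  have h := ((tendsto_add_atTop_iff_nat 1).2 hc).mul_const r⁻¹
  rw [zero_mul] at h
  refine h.congr fun i => ?_
  rw [pow_succ]
  field_simp

theorem convergesOn_shift {c : ℕ → k} {r : ℝ} (hr : 0 < r) (hc : ConvergesOn c r) (m : ℕ) :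
    ConvergesOn (fun i => c (m + i)) r := by
  induction m with
  | zero => simpa using hc
  | succ m ih =>
    refine (convergesOn_succ hr ih).congr fun i => ?_
    simp only [show m + (i + 1) = m + 1 + i by ring]

theorem norm_shift_bound {c : ℕ → k} {r K : ℝ} (hr : 0 < r) {m : ℕ}
    (hK : ∀ i, m ≤ i → ‖c i‖ * r ^ i ≤ K) (i : ℕ) : ‖c (m + i)‖ * r ^ i ≤ K / r ^ m := by
  rw [le_div_iff₀ (pow_pos hr m)]
  calc ‖c (m + i)‖ * r ^ i * r ^ m = ‖c (m + i)‖ * r ^ (m + i) := by ring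
    _ ≤ K := hK _ (by omega)

section Ultrametric

variable [IsUltrametricDist k]

theorem norm_sub_le_max (x y : k) : ‖x - y‖ ≤ max ‖x‖ ‖y‖ := by
  simpa [sub_eq_add_neg] using IsUltrametricDist.norm_add_le_max x (-y)

theorem norm_add_eq_left {x y : k} (h : ‖y‖ < ‖x‖) : ‖x + y‖ = ‖x‖ := by
  rw [IsUltrametricDist.norm_add_eq_max_of_norm_ne_norm h.ne', max_eq_left h.le]

theorem norm_sub_eq_left {x y : k} (h : ‖y‖ < ‖x‖) : ‖x - y‖ = ‖x‖ := by
  rw [sub_eq_add_neg, norm_add_eq_left (by rwa [norm_neg])]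

theorem norm_sub_eq_right {x y : k} (h : ‖x‖ < ‖y‖) : ‖x - y‖ = ‖y‖ := by
  rw [← norm_neg, neg_sub, norm_sub_eq_left h]

theorem summable [CompleteSpace k] {c : ℕ → k} {r : ℝ} (hc : ConvergesOn c r) {x : k}
    (hx : ‖x‖ ≤ r) : Summable fun i => c i * x ^ i := by
  apply NonarchimedeanAddGroup.summable_of_tendsto_cofinite_zero
  rw [Nat.cofinite_eq_atTop]
  exact squeeze_zero_norm (fun i => norm_term_le hx (c i) i) hc

theorem norm_eval_le {c : ℕ → k} {r K : ℝ} (hK : ∀ i, ‖c i‖ * r ^ i ≤ K) {x : k}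
    (hx : ‖x‖ ≤ r) : ‖eval c x‖ ≤ K :=
  IsUltrametricDist.norm_tsum_le_of_forall_le fun i => (norm_term_le hx _ _).trans (hK i)

theorem eval_eq_add [CompleteSpace k] {c : ℕ → k} {r : ℝ} (hc : ConvergesOn c r) {x : k}
    (hx : ‖x‖ ≤ r) : eval c x = c 0 + x * eval (fun i => c (i + 1)) x := by
  have hs := summable hc hx
  rw [eval, hs.tsum_eq_zero_add, eval, ← tsum_mul_left]
  simp only [pow_zero, mul_one]
  congr 2
  ext i
  ring

theorem norm_eval_sub_const_le [CompleteSpace k] {c : ℕ → k} {r K : ℝ} (hr : 0 < r)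
    (hc : ConvergesOn c r) (hK : ∀ i, ‖c i‖ * r ^ i ≤ K) {x : k} (hx : ‖x‖ ≤ r) :
    ‖eval c x - c 0‖ ≤ ‖x‖ * (K / r) := by
  rw [eval_eq_add hc hx, add_sub_cancel_left, norm_mul]
  gcongr
  refine norm_eval_le (fun i => ?_) hx
  rw [le_div_iff₀ hr]
  calc ‖c (i + 1)‖ * r ^ i * r = ‖c (i + 1)‖ * r ^ (i + 1) := by ring
    _ ≤ K := hK _

theorem norm_eval_of_isDominant_zero [CompleteSpace k] {c : ℕ → k} {r : ℝ} (hr : 0 < r)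
    (hc : ConvergesOn c r) (hd : IsDominant c r 0) {x : k} (hx : ‖x‖ ≤ r) :
    ‖eval c x‖ = ‖c 0‖ := by
  have hpos : 0 < ‖c 0‖ := norm_pos_iff.2 hd.ne_zero
  obtain ⟨K', hK', h0, hK⟩ := exists_lt_bound (m := 1) hc hpos
    (fun i hi => by simpa using hd.lt i hi)
  rw [eval_eq_add hc hx]
  apply norm_add_eq_left
  have : ‖eval (fun i => c (i + 1)) x‖ ≤ K' / r := by
    refine norm_eval_le (fun i => ?_) hx
    rw [le_div_iff₀ hr]
    calc ‖c (i + 1)‖ * r ^ i * r = ‖c (i + 1)‖ * r ^ (i + 1) := by ring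
      _ ≤ K' := hK _ (by omega)
  rw [norm_mul]
  calc ‖x‖ * ‖eval (fun i => c (i + 1)) x‖ ≤ r * (K' / r) := by gcongr
    _ = K' := by field_simp
    _ < _ := hK'

/-- The coefficients of the quotient of `∑ c i * T ^ i` by `T - x`. -/
def divCoeff (c : ℕ → k) (x : k) (i : ℕ) : k := eval (fun j => c (i + 1 + j)) x

theorem norm_divCoeff_le {c : ℕ → k} {r K : ℝ} (hr : 0 < r) {x : k} (hx : ‖x‖ ≤ r) {i : ℕ}
    (hK : ∀ j, i + 1 ≤ j → ‖c j‖ * r ^ j ≤ K) : ‖divCoeff c x i‖ * r ^ (i + 1) ≤ K := by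
  rw [← le_div_iff₀ (pow_pos hr _)]
  exact norm_eval_le (norm_shift_bound hr hK) hx

theorem divCoeff_rec [CompleteSpace k] {c : ℕ → k} {r : ℝ} (hr : 0 < r) (hc : ConvergesOn c r)
    {x : k} (hx : ‖x‖ ≤ r) (i : ℕ) :
    divCoeff c x i = c (i + 1) + x * divCoeff c x (i + 1) := by
  rw [divCoeff, eval_eq_add (convergesOn_shift hr hc (i + 1)) hx, divCoeff]
  simp only [add_zero]
  congr 3
  ext j
  congr 1
  ring

theorem convergesOn_divCoeff {c : ℕ → k} {r : ℝ} (hr : 0 < r) (hc : ConvergesOn c r)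
    {x : k} (hx : ‖x‖ ≤ r) : ConvergesOn (divCoeff c x) r := by
  rw [ConvergesOn, Metric.tendsto_atTop] at *
  intro ε hε
  obtain ⟨N, hN⟩ := hc (ε / 2 * r) (by positivity)
  refine ⟨N, fun n hn => ?_⟩
  have := norm_divCoeff_le (K := ε / 2 * r) hr hx (i := n) (c := c) (fun j hj => by
    have := hN j (by omega)
    rw [Real.dist_eq, sub_zero, abs_of_nonneg (by positivity)] at this
    exact this.le)
  rw [Real.dist_eq, sub_zero, abs_of_nonneg (by positivity)]
  have h2 : ‖divCoeff c x n‖ * r ^ n ≤ ε / 2 := by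
    rw [pow_succ, ← mul_assoc] at this
    exact le_of_mul_le_mul_right this hr
  linarith

theorem eval_eq_mul_divCoeff [CompleteSpace k] {c : ℕ → k} {r : ℝ} (hr : 0 < r)
    (hc : ConvergesOn c r) {x : k} (hx : ‖x‖ ≤ r) {t : k} (ht : ‖t‖ ≤ r) :
    eval c t = eval c x + (t - x) * eval (divCoeff c x) t := by
  have hh := convergesOn_divCoeff hr hc hx
  have h1 : eval c x = c 0 + x * divCoeff c x 0 := by
    rw [eval_eq_add hc hx, divCoeff]
    congr 3
    ext j
    congr 1
    ring
  have h2 := eval_eq_add hh ht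
  have h3 : eval (divCoeff c x) t
      = eval (fun i => c (i + 1)) t + x * eval (fun i => divCoeff c x (i + 1)) t := by
    rw [eval, eval, eval, ← tsum_mul_left, ← (summable (convergesOn_succ hr hc) ht).tsum_add
      ((summable (convergesOn_succ hr hh) ht).mul_left x)]
    congr 1
    ext i
    rw [divCoeff_rec hr hc hx]
    ring
  rw [eval_eq_add hc ht, h1]
  linear_combination (-t) * h3 + x * h2

theorem isDominant_divCoeff [CompleteSpace k] {c : ℕ → k} {r : ℝ} (hr : 0 < r)
    (hc : ConvergesOn c r) {n : ℕ} (hd : IsDominant c r (n + 1)) {x : k} (hx : ‖x‖ ≤ r) :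
    IsDominant (divCoeff c x) r n := by
  have hpos : 0 < ‖c (n + 1)‖ * r ^ (n + 1) :=
    mul_pos (norm_pos_iff.2 hd.ne_zero) (pow_pos hr _)
  obtain ⟨K', hK', h0, hK⟩ := exists_lt_bound (m := n + 2) hc hpos
    (fun i hi => hd.lt i (by omega))
  have hbig : ∀ i, n < i → ‖divCoeff c x i‖ * r ^ (i + 1) ≤ K' := fun i hi =>
    norm_divCoeff_le hr hx fun j hj => hK j (by omega)
  have hn : ‖divCoeff c x n‖ = ‖c (n + 1)‖ := by
    rw [divCoeff_rec hr hc hx]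
    apply norm_add_eq_left
    have h1 := hbig (n + 1) (by omega)
    rw [norm_mul]
    have h2 : ‖x‖ * ‖divCoeff c x (n + 1)‖ * r ^ (n + 1) < ‖c (n + 1)‖ * r ^ (n + 1) := by
      calc ‖x‖ * ‖divCoeff c x (n + 1)‖ * r ^ (n + 1)
          ≤ r * ‖divCoeff c x (n + 1)‖ * r ^ (n + 1) := by gcongr
        _ = ‖divCoeff c x (n + 1)‖ * r ^ (n + 1 + 1) := by ring
        _ ≤ K' := h1
        _ < _ := hK'
    exact lt_of_mul_lt_mul_right h2 (by positivity)
  refine ⟨norm_pos_iff.1 (hn ▸ norm_pos_iff.2 hd.ne_zero), fun i => ?_, fun i hi => ?_⟩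
  · have := norm_divCoeff_le hr hx (i := i) (c := c) fun j _ => hd.le j
    rw [hn]
    rw [pow_succ, pow_succ, ← mul_assoc, ← mul_assoc] at this
    exact le_of_mul_le_mul_right this hr
  · have := (hbig i hi).trans_lt hK'
    rw [hn]
    rw [pow_succ, pow_succ, ← mul_assoc, ← mul_assoc] at this
    exact lt_of_mul_lt_mul_right this hr.le

end Ultrametric

end NonarchSeries

namespace NonarchSeries

theorem pow_card_le_prod_map {α : Type*} {s : Multiset α} {g : α → ℝ} {δ : ℝ} (hδ : 0 ≤ δ)
    (h : ∀ x ∈ s, δ ≤ g x) : δ ^ s.card ≤ (s.map g).prod := by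
  induction s using Multiset.induction_on with
  | empty => simp
  | cons x s ih =>
    rw [Multiset.card_cons, Multiset.map_cons, Multiset.prod_cons, pow_succ']
    have := h x (Multiset.mem_cons_self _ _)
    exact mul_le_mul this (ih fun z hz => h z (Multiset.mem_cons_of_mem hz)) (by positivity)
      (hδ.trans this)

section Polynomial

open Polynomial

variable [IsUltrametricDist k]

theorem isDominant_X_sub_C_mul_of_le {p : k[X]} {r : ℝ} (hr : 0 < r) {n : ℕ}
    (hp : IsDominant p.coeff r n) {x : k} (hx : ‖x‖ ≤ r) :
    IsDominant ((X - C x) * p).coeff r (n + 1) ∧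
      ‖((X - C x) * p).coeff (n + 1)‖ = ‖p.coeff n‖ := by
  have hcoeff : ∀ i, ((X - C x) * p).coeff (i + 1) = p.coeff i - x * p.coeff (i + 1) := by
    intro i
    rw [sub_mul, coeff_sub, coeff_X_mul, coeff_C_mul]
  have hxb : ∀ i, ‖x * p.coeff i‖ * r ^ i ≤ r * (‖p.coeff i‖ * r ^ i) := by
    intro i
    rw [norm_mul, mul_assoc]
    gcongr
  have hn : ‖((X - C x) * p).coeff (n + 1)‖ = ‖p.coeff n‖ := by
    rw [hcoeff]
    apply norm_sub_eq_left
    have : ‖x * p.coeff (n + 1)‖ * r ^ (n + 1) < ‖p.coeff n‖ * r ^ (n + 1) := by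
      calc _ ≤ _ := hxb (n + 1)
        _ < r * (‖p.coeff n‖ * r ^ n) := mul_lt_mul_of_pos_left (hp.lt _ (by omega)) hr
        _ = _ := by ring
    exact lt_of_mul_lt_mul_right this (by positivity)
  refine ⟨⟨?_, ?_, ?_⟩, hn⟩
  · rw [← norm_pos_iff, hn, norm_pos_iff]
    exact hp.ne_zero
  · intro i
    rw [hn, show ‖p.coeff n‖ * r ^ (n + 1) = r * (‖p.coeff n‖ * r ^ n) by ring]
    cases i with
    | zero =>
      rw [sub_mul, coeff_sub, coeff_X_mul_zero, coeff_C_mul, zero_sub, norm_neg]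
      exact (hxb 0).trans (mul_le_mul_of_nonneg_left (hp.le 0) hr.le)
    | succ i =>
      rw [hcoeff]
      have h1 : ‖p.coeff i‖ * r ^ (i + 1) ≤ r * (‖p.coeff n‖ * r ^ n) := by
        calc _ = r * (‖p.coeff i‖ * r ^ i) := by ring
          _ ≤ _ := mul_le_mul_of_nonneg_left (hp.le i) hr.le
      have h2 : ‖x * p.coeff (i + 1)‖ * r ^ (i + 1) ≤ r * (‖p.coeff n‖ * r ^ n) :=
        (hxb _).trans (mul_le_mul_of_nonneg_left (hp.le _) hr.le)
      calc _ ≤ max ‖p.coeff i‖ ‖x * p.coeff (i + 1)‖ * r ^ (i + 1) := by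
            gcongr; exact norm_sub_le_max _ _
        _ ≤ _ := by
            rcases max_choice ‖p.coeff i‖ ‖x * p.coeff (i + 1)‖ with h | h <;> rwa [h]
  · intro i hi
    rw [hn, show ‖p.coeff n‖ * r ^ (n + 1) = r * (‖p.coeff n‖ * r ^ n) by ring]
    obtain ⟨i, rfl⟩ : ∃ j, i = j + 1 := ⟨i - 1, by omega⟩
    rw [hcoeff]
    have h1 : ‖p.coeff i‖ * r ^ (i + 1) < r * (‖p.coeff n‖ * r ^ n) := by
      calc _ = r * (‖p.coeff i‖ * r ^ i) := by ring
        _ < _ := mul_lt_mul_of_pos_left (hp.lt i (by omega)) hr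
    have h2 : ‖x * p.coeff (i + 1)‖ * r ^ (i + 1) < r * (‖p.coeff n‖ * r ^ n) :=
      (hxb _).trans_lt (mul_lt_mul_of_pos_left (hp.lt _ (by omega)) hr)
    calc _ ≤ max ‖p.coeff i‖ ‖x * p.coeff (i + 1)‖ * r ^ (i + 1) := by
          gcongr; exact norm_sub_le_max _ _
      _ < _ := by
          rcases max_choice ‖p.coeff i‖ ‖x * p.coeff (i + 1)‖ with h | h <;> rwa [h]

theorem isDominant_X_sub_C_mul_of_lt {p : k[X]} {r : ℝ} (hr : 0 < r) {n : ℕ}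
    (hp : IsDominant p.coeff r n) {x : k} (hx : r < ‖x‖) :
    IsDominant ((X - C x) * p).coeff r n ∧
      ‖((X - C x) * p).coeff n‖ = ‖x‖ * ‖p.coeff n‖ := by
  have hpos : 0 < ‖p.coeff n‖ * r ^ n := mul_pos (norm_pos_iff.2 hp.ne_zero) (pow_pos hr _)
  have hcoeff : ∀ i, ((X - C x) * p).coeff (i + 1) = p.coeff i - x * p.coeff (i + 1) := by
    intro i
    rw [sub_mul, coeff_sub, coeff_X_mul, coeff_C_mul]
  have hcoeff0 : ((X - C x) * p).coeff 0 = - (x * p.coeff 0) := by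
    rw [sub_mul, coeff_sub, coeff_X_mul_zero, coeff_C_mul, zero_sub]
  have hxb : ∀ i, ‖x * p.coeff i‖ * r ^ i = ‖x‖ * (‖p.coeff i‖ * r ^ i) := by
    intro i
    rw [norm_mul, mul_assoc]
  have hshift : ∀ i, ‖p.coeff i‖ * r ^ (i + 1) < ‖x‖ * (‖p.coeff n‖ * r ^ n) := by
    intro i
    calc _ = r * (‖p.coeff i‖ * r ^ i) := by ring
      _ ≤ r * (‖p.coeff n‖ * r ^ n) := mul_le_mul_of_nonneg_left (hp.le i) hr.le
      _ < _ := by gcongr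
  have hn : ‖((X - C x) * p).coeff n‖ = ‖x‖ * ‖p.coeff n‖ := by
    cases n with
    | zero => rw [hcoeff0, norm_neg, norm_mul]
    | succ n =>
      rw [hcoeff, ← norm_mul]
      apply norm_sub_eq_right
      have := hshift n
      rw [← hxb] at this
      exact lt_of_mul_lt_mul_right this (by positivity)
  refine ⟨⟨?_, ?_, ?_⟩, hn⟩
  · rw [← norm_pos_iff, hn]
    exact mul_pos (hr.trans hx) (norm_pos_iff.2 hp.ne_zero)
  · intro i
    rw [hn, mul_assoc]
    cases i with
    | zero =>
      rw [hcoeff0, norm_neg, hxb]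
      exact mul_le_mul_of_nonneg_left (hp.le 0) (norm_nonneg x)
    | succ i =>
      rw [hcoeff]
      have h2 : ‖x * p.coeff (i + 1)‖ * r ^ (i + 1) ≤ ‖x‖ * (‖p.coeff n‖ * r ^ n) := by
        rw [hxb]
        exact mul_le_mul_of_nonneg_left (hp.le _) (norm_nonneg x)
      calc _ ≤ max ‖p.coeff i‖ ‖x * p.coeff (i + 1)‖ * r ^ (i + 1) := by
            gcongr; exact norm_sub_le_max _ _
        _ ≤ _ := by
            rcases max_choice ‖p.coeff i‖ ‖x * p.coeff (i + 1)‖ with h | h <;> rw [h]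
            exacts [(hshift i).le, h2]
  · intro i hi
    rw [hn, mul_assoc]
    obtain ⟨i, rfl⟩ : ∃ j, i = j + 1 := ⟨i - 1, by omega⟩
    rw [hcoeff]
    have h2 : ‖x * p.coeff (i + 1)‖ * r ^ (i + 1) < ‖x‖ * (‖p.coeff n‖ * r ^ n) := by
      rw [hxb]
      have := hp.lt _ hi
      have hx0 := hr.trans hx
      gcongr
    calc _ ≤ max ‖p.coeff i‖ ‖x * p.coeff (i + 1)‖ * r ^ (i + 1) := by
          gcongr; exact norm_sub_le_max _ _
      _ < _ := by
          rcases max_choice ‖p.coeff i‖ ‖x * p.coeff (i + 1)‖ with h | h <;> rw [h]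
          exacts [hshift i, h2]

/-- The dominant index of a split polynomial is the number of its roots in the closed disc, and
these roots control the absolute value of the polynomial on that disc. -/
theorem isDominant_prod {r : ℝ} (hr : 0 < r) {a : k} (ha : a ≠ 0) (m : Multiset k) :
    ∃ s ≤ m, (∀ x ∈ s, ‖x‖ ≤ r) ∧
      IsDominant (C a * (m.map fun x => X - C x).prod).coeff r s.card ∧
      ∀ t : k, ‖t‖ ≤ r → ‖(C a * (m.map fun x => X - C x).prod).eval t‖ =
        ‖(C a * (m.map fun x => X - C x).prod).coeff s.card‖ *
          (s.map fun x => ‖t - x‖).prod := by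
  induction m using Multiset.induction_on with
  | empty =>
    refine ⟨0, le_rfl, by simp, ⟨by simpa, fun i => ?_, fun i hi => ?_⟩, by simp⟩
    · cases i with
      | zero => simp
      | succ i => simp [coeff_C]
    · have : i ≠ 0 := by rintro rfl; simp at hi
      simpa [coeff_C, this] using ha
  | cons x m ih =>
    obtain ⟨s, hsm, hs, hdom, hev⟩ := ih
    have hp : C a * (((x ::ₘ m).map fun x => X - C x).prod)
        = (X - C x) * (C a * (m.map fun x => X - C x).prod) := by
      rw [Multiset.map_cons, Multiset.prod_cons]
      ring
    rw [hp]
    by_cases hx : ‖x‖ ≤ r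
    · obtain ⟨h1, h2⟩ := isDominant_X_sub_C_mul_of_le hr hdom hx
      refine ⟨x ::ₘ s, Multiset.cons_le_cons _ hsm, ?_, by rwa [Multiset.card_cons], ?_⟩
      · intro z hz
        rcases Multiset.mem_cons.1 hz with rfl | hz
        exacts [hx, hs z hz]
      · intro t ht
        rw [Multiset.card_cons, h2, eval_mul, norm_mul, hev t ht]
        simp
        ring
    · have hx' : r < ‖x‖ := not_le.1 hx
      obtain ⟨h1, h2⟩ := isDominant_X_sub_C_mul_of_lt hr hdom hx'
      refine ⟨s, hsm.trans (Multiset.le_cons_self _ _), hs, h1, fun t ht => ?_⟩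
      rw [h2, eval_mul, norm_mul, hev t ht, eval_sub, eval_X, eval_C,
        norm_sub_eq_right (ht.trans_lt hx')]
      ring

theorem exists_root_near [IsAlgClosed k] {p : k[X]} {r : ℝ} (hr : 0 < r) {n : ℕ} (hn : 0 < n)
    (hp : IsDominant p.coeff r n) {t : k} (ht : ‖t‖ ≤ r) :
    ∃ x, ‖x‖ ≤ r ∧ p.eval x = 0 ∧ ‖p.coeff n‖ * ‖t - x‖ ^ n ≤ ‖p.eval t‖ := by
  classical
  have hp0 : p ≠ 0 := by
    rintro rfl
    exact hp.ne_zero (by simp)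
  have hsplit := (IsAlgClosed.splits p).eq_prod_roots
  obtain ⟨s, hsm, hs, hdom, hev⟩ := isDominant_prod hr (leadingCoeff_ne_zero.2 hp0) p.roots
  rw [← hsplit] at hdom hev
  obtain rfl := hdom.unique hp
  have hne : s.toFinset.Nonempty := by
    obtain ⟨x, hx⟩ := Multiset.card_pos_iff_exists_mem.1 hn
    exact ⟨x, Multiset.mem_toFinset.2 hx⟩
  obtain ⟨x, hx, hmin⟩ := Finset.exists_min_image s.toFinset (fun x => ‖t - x‖) hne
  rw [Multiset.mem_toFinset] at hx
  refine ⟨x, hs x hx, (mem_roots hp0).1 (Multiset.mem_of_le hsm hx), ?_⟩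
  rw [hev t ht]
  gcongr
  exact pow_card_le_prod_map (norm_nonneg _) fun z hz => hmin z (Multiset.mem_toFinset.2 hz)

/-- The polynomial obtained by truncating a power series after degree `N`. -/
def truncation (c : ℕ → k) (N : ℕ) : k[X] := ∑ i ∈ Finset.range (N + 1), monomial i (c i)

end Polynomial

section Zeros

theorem coeff_truncation (c : ℕ → k) (N i : ℕ) :
    (truncation c N).coeff i = if i ≤ N then c i else 0 := by
  rw [truncation, Polynomial.finsetSum_coeff]
  simp only [Polynomial.coeff_monomial, Finset.sum_ite_eq', Finset.mem_range, Nat.lt_succ_iff]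

theorem eval_truncation (c : ℕ → k) (N : ℕ) (t : k) :
    (truncation c N).eval t = ∑ i ∈ Finset.range (N + 1), c i * t ^ i := by
  rw [truncation, Polynomial.eval_finsetSum]
  simp

theorem eval_truncation_succ (c : ℕ → k) (N : ℕ) (t : k) :
    (truncation c (N + 1)).eval t = (truncation c N).eval t + c (N + 1) * t ^ (N + 1) := by
  rw [eval_truncation, eval_truncation, Finset.sum_range_succ]

theorem exists_norm_mem_Ioo [IsAlgClosed k] {r r' : ℝ} (hr : 0 ≤ r) (h : r < r') :
    ∃ x : k, r < ‖x‖ ∧ ‖x‖ < r' := by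
  wlog hpos : 0 < r generalizing r
  · obtain ⟨x, hx, hx'⟩ := this (r := r' / 2) (by linarith) (by linarith) (by linarith)
    exact ⟨x, by linarith, hx'⟩
  obtain ⟨z, hz⟩ := NormedField.exists_one_lt_norm k
  have hq : 1 < r' / r := (one_lt_div hpos).2 h
  obtain ⟨m, hm⟩ := pow_unbounded_of_one_lt ‖z‖ hq
  have hm0 : 0 < m := by
    rcases Nat.eq_zero_or_pos m with rfl | h0
    · rw [pow_zero] at hm
      linarith
    · exact h0
  obtain ⟨w, hw⟩ := IsAlgClosed.exists_pow_nat_eq z hm0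
  rw [← hw, norm_pow] at hz hm
  have hw1 : 1 < ‖w‖ := by
    by_contra hcon
    exact absurd (pow_le_one₀ (n := m) (norm_nonneg w) (not_lt.1 hcon)) (not_le.2 hz)
  have hw2 : ‖w‖ < r' / r := lt_of_pow_lt_pow_left₀ m (by linarith) hm
  obtain ⟨j, hj, hj'⟩ := exists_mem_Ico_zpow hpos hw1
  refine ⟨w ^ (j + 1), by rwa [norm_zpow], ?_⟩
  rw [norm_zpow, zpow_add_one₀ (by positivity)]
  calc _ ≤ r * ‖w‖ := by gcongr
    _ < r * (r' / r) := by gcongr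
    _ = r' := by field_simp

theorem isDominant_truncation {c : ℕ → k} {r : ℝ} (hr : 0 < r) {n : ℕ} (hd : IsDominant c r n)
    {N : ℕ} (hN : n ≤ N) : IsDominant (truncation c N).coeff r n := by
  have hpos : 0 < ‖c n‖ * r ^ n := mul_pos (norm_pos_iff.2 hd.ne_zero) (pow_pos hr _)
  refine ⟨by simpa [coeff_truncation, hN] using hd.ne_zero, fun i => ?_, fun i hi => ?_⟩
  · rw [coeff_truncation, coeff_truncation, if_pos hN]
    split_ifs
    · exact hd.le i
    · simpa using hpos.le
  · rw [coeff_truncation, coeff_truncation, if_pos hN]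
    split_ifs
    · exact hd.lt i hi
    · simpa using hpos

variable [IsUltrametricDist k]

theorem norm_pow_sub_pow_le {r : ℝ} {x y : k} (hx : ‖x‖ ≤ r) (hy : ‖y‖ ≤ r) (i : ℕ) :
    ‖x ^ (i + 1) - y ^ (i + 1)‖ ≤ ‖x - y‖ * r ^ i := by
  have hr : 0 ≤ r := (norm_nonneg x).trans hx
  induction i with
  | zero => simp
  | succ i ih =>
    have : x ^ (i + 1 + 1) - y ^ (i + 1 + 1)
        = x * (x ^ (i + 1) - y ^ (i + 1)) + (x - y) * y ^ (i + 1) := by ring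
    rw [this]
    refine (IsUltrametricDist.norm_add_le_max _ _).trans (max_le ?_ ?_)
    · rw [norm_mul]
      calc _ ≤ r * (‖x - y‖ * r ^ i) := by gcongr
        _ = _ := by ring
    · rw [norm_mul, norm_pow]
      gcongr

theorem norm_eval_truncation_sub_le {c : ℕ → k} {r K : ℝ} (hr : 0 < r) (hK : ∀ i, ‖c i‖ * r ^ i ≤ K)
    {x y : k} (hx : ‖x‖ ≤ r) (hy : ‖y‖ ≤ r) (N : ℕ) :
    ‖(truncation c N).eval x - (truncation c N).eval y‖ ≤ ‖x - y‖ * (K / r) := by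
  have hK0 : 0 ≤ K := le_trans (by positivity) (hK 0)
  rw [eval_truncation, eval_truncation, ← Finset.sum_sub_distrib]
  refine IsUltrametricDist.norm_sum_le_of_forall_le_of_nonneg (by positivity) fun i _ => ?_
  cases i with
  | zero => simp; positivity
  | succ i =>
    rw [← mul_sub, norm_mul]
    calc _ ≤ ‖c (i + 1)‖ * (‖x - y‖ * r ^ i) := by gcongr; exact norm_pow_sub_pow_le hx hy i
      _ = ‖x - y‖ * (‖c (i + 1)‖ * r ^ (i + 1) / r) := by rw [pow_succ]; field_simp
      _ ≤ _ := by gcongr; exact hK _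

/-- A convergent power series with positive dominant index has a zero in the closed disc. -/
theorem exists_zero [IsAlgClosed k] [CompleteSpace k] {c : ℕ → k} {r : ℝ} (hr : 0 < r)
    (hc : ConvergesOn c r) {n : ℕ} (hn : 0 < n) (hd : IsDominant c r n) :
    ∃ x, ‖x‖ ≤ r ∧ eval c x = 0 := by
  have hcn : 0 < ‖c n‖ := norm_pos_iff.2 hd.ne_zero
  have hstep : ∀ (N : ℕ) (t : {t : k // ‖t‖ ≤ r ∧ (truncation c (n + N)).eval t = 0}),
      ∃ t' : {t : k // ‖t‖ ≤ r ∧ (truncation c (n + (N + 1))).eval t = 0},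
        ‖c n‖ * ‖t.1 - t'.1‖ ^ n ≤ ‖c (n + N + 1)‖ * r ^ (n + N + 1) := by
    rintro N ⟨t, ht, ht0⟩
    have hdt := isDominant_truncation hr hd (N := n + N + 1) (by omega)
    obtain ⟨x, hx, hx0, hxt⟩ := exists_root_near hr hn hdt ht
    refine ⟨⟨x, hx, hx0⟩, ?_⟩
    rw [coeff_truncation, if_pos (by omega), eval_truncation_succ, ht0, zero_add] at hxt
    exact hxt.trans (norm_term_le ht _ _)
  obtain ⟨x₀, hx₀, hx₀', -⟩ := exists_root_near hr hn
    (isDominant_truncation hr hd (N := n + 0) (by omega)) (t := 0) (by simpa using hr.le)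
  choose next hnext using hstep
  let u : (N : ℕ) → {t : k // ‖t‖ ≤ r ∧ (truncation c (n + N)).eval t = 0} :=
    fun N => Nat.rec ⟨x₀, hx₀, hx₀'⟩ next N
  have hu : ∀ N, ‖c n‖ * ‖(u N).1 - (u (N + 1)).1‖ ^ n ≤ ‖c (n + N + 1)‖ * r ^ (n + N + 1) :=
    fun N => hnext N (u N)
  have hpow : Tendsto (fun N => ‖(u (N + 1)).1 - (u N).1‖ ^ n) atTop (𝓝 0) := by
    have hlim : Tendsto (fun N => (‖c (N + (n + 1))‖ * r ^ (N + (n + 1))) / ‖c n‖) atTop (𝓝 0) := by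
      simpa using ((tendsto_add_atTop_iff_nat (n + 1)).2 hc).div_const ‖c n‖
    refine squeeze_zero (fun N => by positivity) (fun N => ?_) hlim
    rw [le_div_iff₀ hcn, mul_comm, norm_sub_rev, show N + (n + 1) = n + N + 1 by ring]
    exact hu N
  have hdiff : Tendsto (fun N => (u (N + 1)).1 - (u N).1) atTop (𝓝 0) := by
    rw [tendsto_zero_iff_norm_tendsto_zero]
    rw [Metric.tendsto_atTop] at hpow ⊢
    intro ε hε
    obtain ⟨N, hN⟩ := hpow (ε ^ n) (by positivity)
    refine ⟨N, fun m hm => ?_⟩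
    have := hN m hm
    rw [Real.dist_eq, sub_zero, abs_of_nonneg (by positivity)] at this ⊢
    exact lt_of_pow_lt_pow_left₀ n hε.le this
  obtain ⟨x, hx⟩ := cauchySeq_tendsto_of_complete
    (NonarchimedeanAddGroup.cauchySeq_of_tendsto_sub_nhds_zero (f := fun N => (u N).1) hdiff)
  have hxr : ‖x‖ ≤ r := le_of_tendsto hx.norm (Eventually.of_forall fun N => (u N).2.1)
  refine ⟨x, hxr, ?_⟩
  have h1 : Tendsto (fun N => (truncation c (n + N)).eval x) atTop (𝓝 (eval c x)) := by
    have := (summable hc hxr).hasSum.tendsto_sum_nat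
    have := (tendsto_add_atTop_iff_nat (n + 1)).2 this
    refine this.congr fun N => ?_
    rw [eval_truncation, show N + (n + 1) = n + N + 1 by ring]
  have h2 : Tendsto (fun N => (truncation c (n + N)).eval x) atTop (𝓝 0) := by
    have hb : Tendsto (fun N => ‖x - (u N).1‖ * (‖c n‖ * r ^ n / r)) atTop (𝓝 0) := by
      have : Tendsto (fun N => ‖x - (u N).1‖) atTop (𝓝 0) := by
        simpa using (tendsto_const_nhds (x := x) |>.sub hx).norm
      simpa using this.mul_const (‖c n‖ * r ^ n / r)
    refine squeeze_zero_norm (fun N => ?_) hb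
    have := norm_eval_truncation_sub_le hr hd.le hxr (u N).2.1 (n + N)
    rwa [(u N).2.2, sub_zero] at this
  exact tendsto_nhds_unique h1 h2

/-- A finite set of zeros can be divided out of a power series, lowering the dominant index by its
cardinality. -/
theorem exists_factorization [CompleteSpace k] {c : ℕ → k} {r : ℝ} (hr : 0 < r)
    (hc : ConvergesOn c r) {n : ℕ} (hd : IsDominant c r n) (B : Finset k)
    (hB : ∀ x ∈ B, ‖x‖ ≤ r ∧ eval c x = 0) :
    ∃ (h : ℕ → k) (m : ℕ), m + B.card = n ∧ ConvergesOn h r ∧ IsDominant h r m ∧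
      ∀ t, ‖t‖ ≤ r → eval c t = (∏ x ∈ B, (t - x)) * eval h t := by
  classical
  induction B using Finset.induction_on with
  | empty => exact ⟨c, n, by simp, hc, hd, fun t _ => by simp⟩
  | insert x B hxB ih =>
    obtain ⟨h, m, hm, hh, hdh, hev⟩ := ih fun z hz => hB z (Finset.mem_insert_of_mem hz)
    obtain ⟨hx, hx0⟩ := hB x (Finset.mem_insert_self _ _)
    have hhx : eval h x = 0 := by
      have h1 := hev x hx
      rw [hx0, eq_comm, mul_eq_zero] at h1
      refine h1.resolve_left (Finset.prod_ne_zero_iff.2 fun z hz h => hxB ?_)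
      rwa [sub_eq_zero.1 h]
    obtain ⟨m, rfl⟩ : ∃ j, m = j + 1 := by
      cases m with
      | succ m => exact ⟨m, rfl⟩
      | zero =>
        have := norm_eval_of_isDominant_zero hr hh hdh hx
        rw [hhx, norm_zero, eq_comm, norm_eq_zero] at this
        exact absurd this hdh.ne_zero
    refine ⟨divCoeff h x, m, ?_, convergesOn_divCoeff hr hh hx, isDominant_divCoeff hr hh hdh hx,
      fun t ht => ?_⟩
    · rw [Finset.card_insert_of_notMem hxB]
      omega
    · rw [hev t ht, eval_eq_mul_divCoeff hr hh hx ht, hhx, Finset.prod_insert hxB]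
      ring

/-- If `B` is the set of all zeros of a power series in the closed disc and all of them are simple,
then the dominant index is the cardinality of `B`. -/
theorem card_zeros [IsAlgClosed k] [CompleteSpace k] {c : ℕ → k} {r : ℝ} (hr : 0 < r)
    (hc : ConvergesOn c r) {n : ℕ} (hd : IsDominant c r n) (B : Finset k)
    (hB : ∀ x, x ∈ B ↔ ‖x‖ ≤ r ∧ eval c x = 0)
    (hsimple : ∀ x ∈ B, ¬ ∃ K : ℝ, ∀ t, ‖t‖ ≤ r → ‖eval c t‖ ≤ K * ‖t - x‖ ^ 2) :
    B.card = n := by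
  classical
  obtain ⟨h, m, hm, hh, hdh, hev⟩ := exists_factorization hr hc hd B fun x hx => (hB x).1 hx
  rcases Nat.eq_zero_or_pos m with rfl | hmpos
  · simpa using hm
  exfalso
  obtain ⟨x, hx, hx0⟩ := exists_zero hr hh hmpos hdh
  have hxB : x ∈ B := (hB x).2 ⟨hx, by rw [hev x hx, hx0, mul_zero]⟩
  refine hsimple x hxB ?_
  obtain ⟨K, hK⟩ := exists_bound (convergesOn_divCoeff hr hh hx)
  have hK0 : 0 ≤ K := le_trans (by positivity) (hK 0)
  refine ⟨r ^ (B.erase x).card * K, fun t ht => ?_⟩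
  rw [hev t ht, eval_eq_mul_divCoeff hr hh hx ht, hx0, zero_add,
    ← Finset.mul_prod_erase B _ hxB, norm_mul, norm_mul, norm_mul, norm_prod]
  have h1 : ∏ z ∈ B.erase x, ‖t - z‖ ≤ r ^ (B.erase x).card := by
    rw [← Finset.prod_const]
    refine Finset.prod_le_prod (fun _ _ => norm_nonneg _) fun z hz => ?_
    exact (norm_sub_le_max _ _).trans
      (max_le ht ((hB z).1 (Finset.mem_of_mem_erase hz)).1)
  have h2 := norm_eval_le hK ht
  calc _ = (∏ z ∈ B.erase x, ‖t - z‖) * ‖eval (divCoeff h x) t‖ * ‖t - x‖ ^ 2 := by ring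
    _ ≤ _ := by gcongr

end Zeros

end NonarchSeries

namespace DiscMorphism

open NonarchSeries

theorem norm_add_lt_one [IsUltrametricDist k] (a : UnitDisc k) {x : k} (hx : ‖x‖ < 1) :
    ‖(a : k) + x‖ < 1 :=
  (IsUltrametricDist.norm_add_le_max _ _).trans_lt (max_lt a.2 hx)

theorem norm_sub_lt_one [IsUltrametricDist k] (a b : UnitDisc k) : ‖(a : k) - b‖ < 1 :=
  (norm_sub_le_max _ _).trans_lt (max_lt a.2 b.2)

theorem eval_coeff (F : DiscMorphism k) (a b : UnitDisc k) :
    eval (F.coeff a) ((b : k) - a) = (F.toFun b : k) - F.toFun a :=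
  (F.expansion a b).tsum_eq

theorem eval_coeff_of_norm_lt [IsUltrametricDist k] (F : DiscMorphism k) (a : UnitDisc k) {x : k}
    (hx : ‖x‖ < 1) :
    eval (F.coeff a) x = (F.toFun ⟨(a : k) + x, norm_add_lt_one a hx⟩ : k) - F.toFun a := by
  rw [← eval_coeff]
  simp

theorem convergesOn_coeff [IsUltrametricDist k] [IsAlgClosed k] (F : DiscMorphism k)
    (a : UnitDisc k) {s : ℝ} (hs : 0 < s) (hs1 : s < 1) : ConvergesOn (F.coeff a) s := by
  obtain ⟨x, hx, hx1⟩ := exists_norm_mem_Ioo (k := k) hs.le hs1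
  have h := (F.expansion a ⟨a + x, norm_add_lt_one a hx1⟩).summable.tendsto_atTop_zero.norm
  rw [norm_zero] at h
  refine squeeze_zero (fun i => by positivity) (fun i => ?_) h
  rw [add_sub_cancel_left, norm_mul, norm_pow]
  gcongr

theorem mult_eq_one {F : DiscMorphism k} (het : F.Etale) (b : UnitDisc k) :
    sInf {i | 1 ≤ i ∧ F.coeff b i ≠ 0} = 1 := by
  apply le_antisymm
  · exact Nat.sInf_le ⟨le_rfl, het b⟩
  · exact (Nat.sInf_mem (s := {i | 1 ≤ i ∧ F.coeff b i ≠ 0}) ⟨1, le_rfl, het b⟩).1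

theorem exists_fiber {F : DiscMorphism k} (het : F.Etale) (y : UnitDisc k) :
    ∃ S : Finset (UnitDisc k), (∀ b, b ∈ S ↔ F.toFun b = y) ∧ S.card = F.degree := by
  obtain ⟨S, hS, hcard⟩ := F.finite_fibers y
  refine ⟨S, fun b => (hS b).symm, ?_⟩
  simpa [mult_eq_one het] using hcard

/-- The number of points of the fiber through `a` that lie in `D(a,s)`. -/
def localDegree (F : DiscMorphism k) (a : UnitDisc k) (s : ℝ) : ℕ :=
  Set.ncard {b : UnitDisc k | F.toFun b = F.toFun a ∧ ‖(b : k) - a‖ ≤ s}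

theorem localDegree_le {F : DiscMorphism k} (het : F.Etale) (a : UnitDisc k) (s : ℝ) :
    F.localDegree a s ≤ F.degree := by
  obtain ⟨S, hS, hcard⟩ := exists_fiber het (F.toFun a)
  rw [← hcard, ← Set.ncard_coe_finset]
  exact Set.ncard_le_ncard (fun b hb => (hS b).2 hb.1) S.finite_toSet

theorem localDegree_mono {F : DiscMorphism k} (het : F.Etale) (a : UnitDisc k) {s s' : ℝ}
    (h : s ≤ s') : F.localDegree a s ≤ F.localDegree a s' := by
  obtain ⟨S, hS, -⟩ := exists_fiber het (F.toFun a)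
  exact Set.ncard_le_ncard (fun b hb => ⟨hb.1, hb.2.trans h⟩)
    (S.finite_toSet.subset fun b hb => (hS b).2 hb.1)

/-- At an étale point `f - f(b)` does not vanish to second order. -/
theorem not_quadratic [IsUltrametricDist k] [IsAlgClosed k] [CompleteSpace k]
    {F : DiscMorphism k} (het : F.Etale) (b : UnitDisc k) {s : ℝ} (hs : 0 < s) (hs1 : s < 1) :
    ¬ ∃ K : ℝ, ∀ v, ‖v‖ ≤ s → ‖eval (F.coeff b) v‖ ≤ K * ‖v‖ ^ 2 := by
  rintro ⟨K, hK⟩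
  have hc := F.convergesOn_coeff b hs hs1
  have hu := convergesOn_succ hs hc
  obtain ⟨K', hK'⟩ := exists_bound hu
  have hK'0 : 0 ≤ K' := le_trans (by positivity) (hK' 0)
  have hc1 : 0 < ‖F.coeff b 1‖ := norm_pos_iff.2 (het b)
  set M := |K| + K' / s + 1 with hM
  have hMpos : 0 < M := by positivity
  obtain ⟨v, hv0, hv⟩ := NormedField.exists_norm_lt k (lt_min hs (div_pos hc1 hMpos))
  have hvs : ‖v‖ ≤ s := (hv.trans_le (min_le_left _ _)).le
  have hvM : ‖v‖ * M < ‖F.coeff b 1‖ := (lt_div_iff₀ hMpos).1 (hv.trans_le (min_le_right _ _))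
  have h1 := norm_eval_sub_const_le hs hu hK' hvs
  have h2 := hK v hvs
  rw [eval_eq_add hc hvs, F.coeff_zero, zero_add, norm_mul, pow_two, ← mul_assoc,
    mul_comm ‖v‖] at h2
  have h3 := le_of_mul_le_mul_right h2 hv0
  have h4 : ‖F.coeff b 1‖ ≤ ‖eval (fun i => F.coeff b (i + 1)) v‖ +
      ‖eval (fun i => F.coeff b (i + 1)) v - F.coeff b 1‖ := by
    rw [norm_sub_rev (eval _ _)]
    calc ‖F.coeff b 1‖ = ‖eval (fun i => F.coeff b (i + 1)) v +
          (F.coeff b 1 - eval (fun i => F.coeff b (i + 1)) v)‖ := by congr 1; ring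
      _ ≤ _ := norm_add_le _ _
  have h5 : K * ‖v‖ ≤ |K| * ‖v‖ := by gcongr; exact le_abs_self K
  simp only [zero_add] at h1
  nlinarith

theorem isDominant_localDegree [IsUltrametricDist k] [IsAlgClosed k] [CompleteSpace k]
    {F : DiscMorphism k} (het : F.Etale) (a : UnitDisc k) {s : ℝ} (hs : 0 < s) (hs1 : s < 1) :
    IsDominant (F.coeff a) s (F.localDegree a s) := by
  classical
  have hc := F.convergesOn_coeff a hs hs1
  obtain ⟨n, hn⟩ := exists_isDominant hs hc ⟨1, het a⟩
  obtain ⟨S, hS, -⟩ := exists_fiber het (F.toFun a)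
  have hloc : F.localDegree a s = (S.filter fun b : UnitDisc k => ‖(b : k) - a‖ ≤ s).card := by
    rw [localDegree, ← Set.ncard_coe_finset]
    congr 1
    ext b
    simp [hS]
  have hinj : Function.Injective fun b : UnitDisc k => (b : k) - a := fun b b' h =>
    Subtype.ext (sub_left_injective h)
  rw [hloc, ← Finset.card_image_of_injective _ hinj]
  suffices h : (Finset.image (fun b : UnitDisc k => (b : k) - a)
      (S.filter fun b : UnitDisc k => ‖(b : k) - a‖ ≤ s)).card = n by rwa [h]
  refine card_zeros hs hc hn _ (fun x => ?_) ?_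
  · simp only [Finset.mem_image, Finset.mem_filter, hS]
    constructor
    · rintro ⟨b, ⟨hb, hbs⟩, rfl⟩
      refine ⟨hbs, ?_⟩
      rw [eval_coeff, hb, sub_self]
    · rintro ⟨hx, hx0⟩
      have hx1 := hx.trans_lt hs1
      refine ⟨⟨a + x, norm_add_lt_one a hx1⟩, ⟨?_, by simpa using hx⟩, by simp⟩
      rw [eval_coeff_of_norm_lt F a hx1] at hx0
      exact Subtype.ext (sub_eq_zero.1 hx0)
  · intro x hx
    simp only [Finset.mem_image, Finset.mem_filter, hS] at hx
    obtain ⟨b, ⟨hb, hbs⟩, rfl⟩ := hx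
    rintro ⟨K, hK⟩
    refine not_quadratic het b hs hs1 ⟨K, fun v hv => ?_⟩
    have hv1 := hv.trans_lt hs1
    have := hK ((b : k) - a + v) ((IsUltrametricDist.norm_add_le_max _ _).trans (max_le hbs hv))
    rw [add_sub_cancel_left] at this
    rw [eval_coeff_of_norm_lt F b hv1, hb, ← eval_coeff]
    convert this using 3
    simp
    ring

theorem profile_of_isDominant {F : DiscMorphism k} {a : UnitDisc k} {s : ℝ} (hs : 0 < s)
    (hs1 : s < 1) {n : ℕ} (hn : IsDominant (F.coeff a) s n) :
    F.profile a s = ‖F.coeff a n‖ * s ^ n := by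
  have key : ∀ i, F.coeff a i ≠ 0 →
      -Real.log ‖F.coeff a i‖ + i * -Real.log s = -Real.log (‖F.coeff a i‖ * s ^ i) := by
    intro i hi
    rw [Real.log_mul (norm_ne_zero_iff.2 hi) (pow_pos hs i).ne', Real.log_pow]
    ring
  have hpos : ∀ i, F.coeff a i ≠ 0 → 0 < ‖F.coeff a i‖ * s ^ i := fun i hi =>
    mul_pos (norm_pos_iff.2 hi) (pow_pos hs i)
  have hleast : IsLeast {t : ℝ | ∃ i : ℕ, F.coeff a i ≠ 0 ∧
      t = -Real.log ‖F.coeff a i‖ + i * -Real.log s} (-Real.log (‖F.coeff a n‖ * s ^ n)) := by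
    refine ⟨⟨n, hn.ne_zero, (key n hn.ne_zero).symm⟩, ?_⟩
    rintro t ⟨i, hi, rfl⟩
    rw [key i hi]
    exact neg_le_neg (Real.log_le_log (hpos i hi) (hn.le i))
  rw [profile, if_neg (not_le.2 hs), if_neg (not_le.2 hs1), vpol, hleast.csInf_eq, neg_neg,
    Real.exp_log (hpos n hn.ne_zero)]

theorem profile_zero (F : DiscMorphism k) (a : UnitDisc k) : F.profile a 0 = 0 := by
  simp [profile]

theorem profile_one (F : DiscMorphism k) (a : UnitDisc k) : F.profile a 1 = 1 := by
  simp [profile]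

section Etale

variable [IsUltrametricDist k] [IsAlgClosed k] [CompleteSpace k]
variable {F : DiscMorphism k}

theorem profile_eq (het : F.Etale) (a : UnitDisc k) {s : ℝ} (hs : 0 < s) (hs1 : s < 1) :
    F.profile a s = ‖F.coeff a (F.localDegree a s)‖ * s ^ F.localDegree a s :=
  profile_of_isDominant hs hs1 (isDominant_localDegree het a hs hs1)

theorem localDegree_pos (het : F.Etale) (a : UnitDisc k) {s : ℝ} (hs : 0 < s) (hs1 : s < 1) :
    0 < F.localDegree a s := by
  rw [Nat.pos_iff_ne_zero]
  intro h
  have := (isDominant_localDegree het a hs hs1).ne_zero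
  rw [h] at this
  exact this (F.coeff_zero a)

theorem norm_coeff_mul_le_of_lt (het : F.Etale) (a : UnitDisc k) {s : ℝ} (hs : 0 < s)
    (hs1 : s < 1) (i : ℕ) :
    ‖F.coeff a i‖ * s ^ i ≤ F.profile a s := by
  rw [profile_eq het a hs hs1]
  exact (isDominant_localDegree het a hs hs1).le i

theorem profile_pos (het : F.Etale) (a : UnitDisc k) {s : ℝ} (hs : 0 < s)
    (hs1 : s ≤ 1) : 0 < F.profile a s := by
  rcases hs1.lt_or_eq with hs1 | rfl
  · exact lt_of_lt_of_le (mul_pos (norm_pos_iff.2 (het a)) (pow_pos hs 1))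
      (norm_coeff_mul_le_of_lt het a hs hs1 1)
  · simp [profile_one]

theorem exists_preimage (het : F.Etale) (a : UnitDisc k) {s : ℝ} (hs : 0 < s) (hs1 : s < 1) {y : k}
    (hy : ‖y - F.toFun a‖ ≤ F.profile a s) :
    ∃ b : UnitDisc k, ‖(b : k) - a‖ ≤ s ∧ (F.toFun b : k) = y := by
  have hc := F.convergesOn_coeff a hs hs1
  have hd := isDominant_localDegree het a hs hs1
  have hn := localDegree_pos het a hs hs1
  rw [profile_eq het a hs hs1] at hy
  set n := F.localDegree a s
  set c : ℕ → k := fun i => if i = 0 then -(y - F.toFun a) else F.coeff a i with hcdef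
  have hc' : ConvergesOn c s := by
    refine Tendsto.congr' ?_ hc
    filter_upwards [eventually_gt_atTop 0] with i hi
    simp [hcdef, hi.ne']
  have hcn : c n = F.coeff a n := by simp [hcdef, hn.ne']
  have hd' : IsDominant c s n := by
    refine ⟨by rw [hcn]; exact hd.ne_zero, fun i => ?_, fun i hi => ?_⟩
    · rw [hcn]
      rcases Nat.eq_zero_or_pos i with rfl | hi
      · simpa [hcdef, norm_sub_rev] using hy
      · simpa [hcdef, hi.ne'] using hd.le i
    · have : i ≠ 0 := by omega
      rw [hcn]
      simpa [hcdef, this] using hd.lt i hi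
  obtain ⟨x, hx, hx0⟩ := exists_zero hs hc' hn hd'
  have hx1 := hx.trans_lt hs1
  refine ⟨⟨a + x, norm_add_lt_one a hx1⟩, by simpa using hx, ?_⟩
  have h1 := eval_coeff_of_norm_lt F a hx1
  rw [eval_eq_add hc hx, F.coeff_zero, zero_add] at h1
  rw [eval_eq_add hc' hx] at hx0
  have h2 : (fun i => c (i + 1)) = fun i => F.coeff a (i + 1) := by
    ext i
    simp [hcdef]
  rw [h2, h1] at hx0
  simp only [hcdef, if_true] at hx0
  linear_combination hx0

theorem norm_sub_le_profile (het : F.Etale) {a b : UnitDisc k} {s : ℝ} (hs : 0 < s) (hs1 : s < 1)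
    (hb : ‖(b : k) - a‖ ≤ s) : ‖(F.toFun b : k) - F.toFun a‖ ≤ F.profile a s := by
  rw [← eval_coeff]
  exact norm_eval_le (norm_coeff_mul_le_of_lt het a hs hs1) hb

theorem profile_le_of_mem (het : F.Etale) {a b : UnitDisc k} {s : ℝ} (hs : 0 < s) (hs1 : s < 1)
    (hb : ‖(b : k) - a‖ ≤ s) : F.profile b s ≤ F.profile a s := by
  by_contra! hlt
  obtain ⟨z, hz, hz'⟩ := exists_norm_mem_Ioo (k := k) (profile_pos het a hs hs1.le).le hlt
  obtain ⟨t, ht, htz⟩ := exists_preimage het b hs hs1 (y := F.toFun b + z)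
    (by simpa using hz'.le)
  have hta : ‖(t : k) - a‖ ≤ s := by
    rw [← sub_add_sub_cancel (t : k) b a]
    exact (IsUltrametricDist.norm_add_le_max _ _).trans (max_le ht hb)
  have h1 := norm_sub_le_profile het hs hs1 hta
  have h2 := norm_sub_le_profile het hs hs1 hb
  have h3 : z = ((F.toFun t : k) - F.toFun a) - ((F.toFun b : k) - F.toFun a) := by
    rw [htz]; ring
  rw [h3] at hz
  exact absurd ((norm_sub_le_max _ _).trans (max_le h1 h2)) (not_le.2 hz)

theorem profile_eq_of_mem (het : F.Etale) {a b : UnitDisc k} {s : ℝ} (hs : 0 < s) (hs1 : s < 1)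
    (hb : ‖(b : k) - a‖ ≤ s) : F.profile b s = F.profile a s :=
  le_antisymm (profile_le_of_mem het hs hs1 hb)
    (profile_le_of_mem het hs hs1 (by rwa [norm_sub_rev]))

theorem profile_lt_one (het : F.Etale) (a : UnitDisc k) {s : ℝ} (hs : 0 < s) (hs1 : s < 1) :
    F.profile a s < 1 := by
  by_contra! h
  obtain ⟨b, -, hb⟩ := exists_preimage het a hs hs1 (y := F.toFun a + 1) (by simpa using h)
  have := norm_sub_lt_one (F.toFun b) (F.toFun a)
  rw [hb] at this
  simp at this

theorem profile_growth_of_lt (het : F.Etale) (a : UnitDisc k) {s s' : ℝ} (hs : 0 < s) (h : s ≤ s')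
    (hs1 : s' < 1) : F.profile a s * (s' / s) ≤ F.profile a s' ∧
      F.profile a s' ≤ F.profile a s * (s' / s) ^ F.degree := by
  have hs' : 0 < s' := hs.trans_le h
  have hq : 1 ≤ s' / s := (one_le_div hs).2 h
  have hp := profile_pos het a hs (h.trans hs1.le)
  constructor
  · rw [profile_eq het a hs (h.trans_lt hs1)]
    refine le_trans ?_ (norm_coeff_mul_le_of_lt het a hs' hs1 (F.localDegree a s))
    have hn := localDegree_pos het a hs (h.trans_lt hs1)
    set n := F.localDegree a s
    calc ‖F.coeff a n‖ * s ^ n * (s' / s) ≤ ‖F.coeff a n‖ * s ^ n * (s' / s) ^ n := by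
          gcongr
          exact le_self_pow₀ hq hn.ne'
      _ = ‖F.coeff a n‖ * s' ^ n := by rw [div_pow]; field_simp
  · rw [profile_eq het a hs' hs1]
    set n := F.localDegree a s' with hn
    have hnd : n ≤ F.degree := localDegree_le het a s'
    calc ‖F.coeff a n‖ * s' ^ n = ‖F.coeff a n‖ * s ^ n * (s' / s) ^ n := by
          rw [div_pow]; field_simp
      _ ≤ F.profile a s * (s' / s) ^ n := by
          gcongr
          exact norm_coeff_mul_le_of_lt het a hs (h.trans_lt hs1) n
      _ ≤ _ := by gcongr

theorem profile_growth (het : F.Etale) (a : UnitDisc k) {s s' : ℝ} (hs : 0 < s) (h : s ≤ s')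
    (hs1 : s' ≤ 1) :
    F.profile a s * (s' / s) ≤ F.profile a s' ∧
      F.profile a s' ≤ F.profile a s * (s' / s) ^ F.degree := by
  rcases hs1.lt_or_eq with hs1 | rfl
  · exact profile_growth_of_lt het a hs h hs1
  rcases h.lt_or_eq with hs1 | rfl
  swap
  · simp
  have hp := profile_pos het a hs h
  rw [profile_one]
  constructor
  · by_contra! hcon
    have hlt : s < F.profile a s := by
      rw [mul_one_div, lt_div_iff₀ hs] at hcon
      linarith
    have h1 : s / F.profile a s < 1 := (div_lt_one hp).2 hlt
    have h2 : s ≤ s / F.profile a s := by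
      rw [le_div_iff₀ hp]
      exact mul_le_of_le_one_right hs.le (profile_lt_one het a hs hs1).le
    have h3 := (profile_growth_of_lt het a hs h2 h1).1
    have h4 := profile_lt_one het a (hs.trans_le h2) h1
    have h5 : F.profile a s * (s / F.profile a s / s) = 1 := by field_simp
    linarith
  · by_contra! hcon
    obtain ⟨z, hz, hz1⟩ := exists_norm_mem_Ioo (k := k) (by positivity) hcon
    obtain ⟨S, hS, hcard⟩ := exists_fiber het
      (⟨F.toFun a + z, norm_add_lt_one _ hz1⟩ : UnitDisc k)
    obtain ⟨b, hb⟩ := Finset.card_pos.1 (hcard ▸ F.degree_pos)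
    have hb' := congrArg Subtype.val ((hS b).1 hb)
    simp only at hb'
    have hlt : max s ‖(b : k) - a‖ < 1 := max_lt hs1 (norm_sub_lt_one b a)
    have h1 := norm_sub_le_profile het (lt_max_of_lt_left hs) hlt (le_max_right s ‖(b : k) - a‖)
    have h2 := (profile_growth_of_lt het a hs (le_max_left s ‖(b : k) - a‖) hlt).2
    rw [hb', add_sub_cancel_left] at h1
    have h3 : F.profile a s * (max s ‖(b : k) - a‖ / s) ^ F.degree
        ≤ F.profile a s * (1 / s) ^ F.degree := by
      gcongr
    linarith

theorem profile_mono (het : F.Etale) (a : UnitDisc k) {s s' : ℝ} (hs : 0 < s) (h : s ≤ s')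
    (hs1 : s' ≤ 1) :
    F.profile a s ≤ F.profile a s' :=
  (le_mul_of_one_le_right (profile_pos het a hs (h.trans hs1)).le ((one_le_div hs).2 h)).trans
    (profile_growth het a hs h hs1).1

theorem profile_strictMonoOn (het : F.Etale) (a : UnitDisc k) : StrictMonoOn (F.profile a)
    (Icc 0 1) := by
  rintro s ⟨hs, -⟩ s' ⟨-, hs1⟩ h
  rcases hs.lt_or_eq with hs | rfl
  · exact (lt_mul_of_one_lt_right (profile_pos het a hs (h.le.trans hs1))
      ((one_lt_div hs).2 h)).trans_le (profile_growth het a hs h.le hs1).1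
  · rw [profile_zero]
    exact profile_pos het a h hs1

theorem profile_continuousOn (het : F.Etale) (a : UnitDisc k) : ContinuousOn (F.profile a)
    (Icc 0 1) := by
  rintro s ⟨hs, hs1⟩
  rcases hs.lt_or_eq with hs | rfl
  · have hlow : Tendsto (fun t => F.profile a s * min 1 ((t / s) ^ F.degree))
        (𝓝[Icc 0 1] s) (𝓝 (F.profile a s)) := by
      have : Continuous fun t : ℝ => F.profile a s * min 1 ((t / s) ^ F.degree) := by fun_prop
      have h := this.tendsto s
      simp only [div_self hs.ne', one_pow, min_self, mul_one] at h
      exact h.mono_left nhdsWithin_le_nhds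
    have hupp : Tendsto (fun t => F.profile a s * max 1 ((t / s) ^ F.degree))
        (𝓝[Icc 0 1] s) (𝓝 (F.profile a s)) := by
      have : Continuous fun t : ℝ => F.profile a s * max 1 ((t / s) ^ F.degree) := by fun_prop
      have h := this.tendsto s
      simp only [div_self hs.ne', one_pow, max_self, mul_one] at h
      exact h.mono_left nhdsWithin_le_nhds
    have hp := profile_pos het a hs hs1
    have hev : ∀ᶠ t in 𝓝[Icc 0 1] s, 0 < t ∧ t ≤ 1 := by
      filter_upwards [self_mem_nhdsWithin, nhdsWithin_le_nhds (lt_mem_nhds hs)] with t ht ht0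
      exact ⟨ht0, ht.2⟩
    refine tendsto_of_tendsto_of_tendsto_of_le_of_le' hlow hupp ?_ ?_
    · filter_upwards [hev] with t ht
      rcases le_total t s with hts | hts
      · have h := (profile_growth het a ht.1 hts hs1).2
        calc _ ≤ F.profile a s * (t / s) ^ F.degree := by gcongr; exact min_le_right _ _
          _ ≤ F.profile a t * (s / t) ^ F.degree * (t / s) ^ F.degree := by
              have := ht.1
              gcongr
          _ = F.profile a t := by
              have := ht.1
              rw [mul_assoc, ← mul_pow]
              field_simp
              simp
      · exact (mul_le_of_le_one_right hp.le (min_le_left _ _)).trans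
          (profile_mono het a hs hts ht.2)
    · filter_upwards [hev] with t ht
      rcases le_total t s with hts | hts
      · exact (profile_mono het a ht.1 hts hs1).trans
          (le_mul_of_one_le_right hp.le (le_max_left _ _))
      · exact (profile_growth het a hs hts ht.2).2.trans (by gcongr; exact le_max_right _ _)
  · rw [ContinuousWithinAt, profile_zero]
    refine tendsto_of_tendsto_of_tendsto_of_le_of_le' (g := fun _ => 0) (h := fun t => t)
      tendsto_const_nhds (tendsto_id.mono_left nhdsWithin_le_nhds) ?_ ?_
    · filter_upwards [self_mem_nhdsWithin] with t ht
      have := (profile_strictMonoOn het a).monotoneOn (left_mem_Icc.2 zero_le_one) ht ht.1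
      rwa [profile_zero] at this
    · filter_upwards [self_mem_nhdsWithin] with t ht
      rcases ht.1.lt_or_eq with h0 | rfl
      · have h := (profile_growth het a h0 ht.2 le_rfl).1
        rw [profile_one, mul_one_div, div_le_one h0] at h
        exact h
      · rw [profile_zero]

theorem norm_coeff_mul_le (het : F.Etale) (a : UnitDisc k) {s : ℝ} (hs : 0 < s) (hs1 : s ≤ 1)
    (i : ℕ) :
    ‖F.coeff a i‖ * s ^ i ≤ F.profile a s := by
  rcases hs1.lt_or_eq with hs1 | rfl
  · exact norm_coeff_mul_le_of_lt het a hs hs1 i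
  rw [profile_one]
  have h : Tendsto (fun t : ℝ => ‖F.coeff a i‖ * t ^ i) (𝓝[<] 1) (𝓝 (‖F.coeff a i‖ * 1 ^ i)) :=
    (Continuous.tendsto (by fun_prop) 1).mono_left nhdsWithin_le_nhds
  refine le_of_tendsto h ?_
  filter_upwards [self_mem_nhdsWithin, nhdsWithin_le_nhds (lt_mem_nhds one_pos)] with t ht ht0
  exact (norm_coeff_mul_le_of_lt het a ht0 ht i).trans (profile_lt_one het a ht0 ht).le

theorem exists_profile_eq (het : F.Etale) (a : UnitDisc k) {ρ : ℝ} (hρ : 0 < ρ) (hρ1 : ρ < 1) :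
    ∃ s, 0 < s ∧ s < 1 ∧ F.profile a s = ρ := by
  have h := intermediate_value_Ioo zero_le_one (profile_continuousOn het a)
  rw [profile_zero, profile_one] at h
  obtain ⟨s, hs, hs'⟩ := h ⟨hρ, hρ1⟩
  exact ⟨s, hs.1, hs.2, hs'⟩

theorem profile_injOn (het : F.Etale) (a : UnitDisc k) : InjOn (F.profile a) (Icc 0 1) :=
  (profile_strictMonoOn het a).injOn

end Etale

end DiscMorphism

namespace DiscMorphism

open NonarchSeries

section Recentering

variable [IsUltrametricDist k] [IsAlgClosed k] (F : DiscMorphism k)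

/-- The function `f` on `D₁(k)`, extended by zero to `k`. -/
def extend (x : k) : k :=
  open Classical in if h : ‖x‖ < 1 then F.toFun ⟨x, h⟩ else 0

/-- The Taylor series of `f` at `a`. -/
def taylorSeries (a : UnitDisc k) : FormalMultilinearSeries k k k :=
  FormalMultilinearSeries.ofScalars k (Function.update (F.coeff a) 0 (F.toFun a))

theorem one_le_radius_taylorSeries (a : UnitDisc k) : 1 ≤ (F.taylorSeries a).radius := by
  refine ENNReal.le_of_forall_nnreal_lt fun r hr => ?_
  have hr1 : (r : ℝ) < 1 := by exact_mod_cast hr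
  obtain ⟨x, hx, hx1⟩ := exists_norm_mem_Ioo (k := k) r.2 hr1
  have hpos : 0 < ‖x‖ := r.2.trans_lt hx
  have hc := F.convergesOn_coeff a hpos hx1
  refine le_trans (by exact_mod_cast hx.le) ((F.taylorSeries a).le_radius_of_tendsto
    (r := ‖x‖₊) (l := 0) ?_)
  refine Tendsto.congr' ?_ hc
  filter_upwards [eventually_ne_atTop 0] with n hn
  rw [taylorSeries, FormalMultilinearSeries.ofScalars_norm, Function.update_of_ne hn, coe_nnnorm]

theorem hasFPowerSeriesOnBall_extend (a : UnitDisc k) :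
    HasFPowerSeriesOnBall F.extend (F.taylorSeries a) a 1 := by
  refine ⟨F.one_le_radius_taylorSeries a, one_pos, fun {y} hy => ?_⟩
  have hy1 : ‖y‖ < 1 := by simpa [enorm, ← NNReal.coe_lt_coe] using hy
  have hay := norm_add_lt_one a hy1
  have h := F.expansion a ⟨a + y, hay⟩
  simp only [add_sub_cancel_left] at h
  have h' := h.update 0 (F.toFun a : k)
  rw [extend, dif_pos hay]
  convert h' using 1
  · ext n
    rw [taylorSeries, FormalMultilinearSeries.ofScalars_apply_eq, smul_eq_mul]
    rcases eq_or_ne n 0 with rfl | hn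
    · simp
    · simp [hn]
  · simp [F.coeff_zero]

theorem exists_hasSum_coeff [CompleteSpace k] {i : ℕ} (hi : i ≠ 0) (a : UnitDisc k) :
    ∃ e : ℕ → k, ∀ b : UnitDisc k,
      HasSum (fun j => e j * ((b : k) - a) ^ j) (F.coeff b i) := by
  have hrad := F.one_le_radius_taylorSeries a
  have h := (ContinuousMultilinearMap.apply k (fun _ : Fin i => k) k
    (fun _ => 1)).comp_hasFPowerSeriesOnBall
      ((F.taylorSeries a).hasFPowerSeriesOnBall_changeOrigin i (one_pos.trans_le hrad))
  refine ⟨fun j => (((ContinuousMultilinearMap.apply k (fun _ : Fin i => k) k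
    (fun _ => 1)).compFormalMultilinearSeries ((F.taylorSeries a).changeOriginSeries i)).coeff j),
    fun b => ?_⟩
  have hlt : (‖(b : k) - a‖₊ : ENNReal) < 1 := by
    have := norm_sub_lt_one b a
    exact_mod_cast this
  have hs := h.hasSum (y := (b : k) - a)
    (by simpa [enorm] using hlt.trans_le hrad)
  have hchange := (F.hasFPowerSeriesOnBall_extend a).changeOrigin hlt
  rw [add_sub_cancel] at hchange
  have heq := hchange.hasFPowerSeriesAt.eq_formalMultilinearSeries
    (F.hasFPowerSeriesOnBall_extend b).hasFPowerSeriesAt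
  have hval : F.coeff b i = ((F.taylorSeries a).changeOrigin (0 + ((b : k) - a)) i) fun _ => 1 := by
    rw [zero_add, heq, taylorSeries, FormalMultilinearSeries.ofScalars_apply_eq,
      Function.update_of_ne hi]
    simp
  rw [hval]
  refine HasSum.congr_fun hs fun j => ?_
  rw [FormalMultilinearSeries.apply_eq_pow_smul_coeff, smul_eq_mul, mul_comm]

end Recentering

end DiscMorphism

namespace NonarchSeries

variable [IsUltrametricDist k] [IsAlgClosed k] [CompleteSpace k]

/-- The maximum principle on the open unit disc. -/
theorem norm_eq_of_forall_norm_le {e : ℕ → k} {g : UnitDisc k → k} {a : UnitDisc k}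
    (hg : ∀ b : UnitDisc k, HasSum (fun j => e j * ((b : k) - a) ^ j) (g b))
    (h0 : g a ≠ 0) (hmax : ∀ b, ‖g b‖ ≤ ‖g a‖) (b : UnitDisc k) : ‖g b‖ = ‖g a‖ := by
  have hconv : ∀ s : ℝ, 0 < s → s < 1 → ConvergesOn e s := by
    intro s hs hs1
    obtain ⟨x, hx, hx1⟩ := exists_norm_mem_Ioo (k := k) hs.le hs1
    have h := (hg ⟨a + x, DiscMorphism.norm_add_lt_one a hx1⟩).summable.tendsto_atTop_zero.norm
    rw [norm_zero] at h
    refine squeeze_zero (fun i => by positivity) (fun i => ?_) h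
    rw [add_sub_cancel_left, norm_mul, norm_pow]
    gcongr
  have he : ∀ b, g b = eval e ((b : k) - a) := fun b => (hg b).tsum_eq.symm
  have hga : g a = e 0 := by
    rw [he, sub_self, eval, tsum_eq_single 0 (fun j hj => by simp [hj])]
    simp
  have hpos : 0 < ‖g a‖ := norm_pos_iff.2 h0
  obtain ⟨x, hx, hx1⟩ := exists_norm_mem_Ioo (k := k) (norm_nonneg ((b : k) - a))
    (DiscMorphism.norm_sub_lt_one b a)
  have hs : 0 < ‖x‖ := (norm_nonneg _).trans_lt hx
  by_cases hsmall : ∀ j, 0 < j → ‖e j‖ * ‖x‖ ^ j < ‖e 0‖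
  · rw [he, hga]
    refine norm_eval_of_isDominant_zero hs (hconv _ hs hx1) ⟨hga ▸ h0, fun i => ?_, fun i hi => ?_⟩
      hx.le
    · rcases Nat.eq_zero_or_pos i with rfl | hi
      · rfl
      · simpa using (hsmall i hi).le
    · simpa using hsmall i hi
  · push Not at hsmall
    obtain ⟨j, hj, hj'⟩ := hsmall
    exfalso
    obtain ⟨x', hx', hx1'⟩ := exists_norm_mem_Ioo (k := k) hs.le hx1
    have hs' : 0 < ‖x'‖ := hs.trans hx'
    have hej : 0 < ‖e j‖ := by
      by_contra! h
      have : ‖e j‖ = 0 := le_antisymm h (norm_nonneg _)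
      rw [this, zero_mul, ← hga] at hj'
      linarith
    have hlt : ‖e 0‖ < ‖e j‖ * ‖x'‖ ^ j := by
      refine hj'.trans_lt ?_
      gcongr
    obtain ⟨w, hw, hw'⟩ := exists_norm_mem_Ioo (k := k) (norm_nonneg _) hlt
    set c : ℕ → k := Function.update e 0 (e 0 - w) with hc
    have hcc : ConvergesOn c ‖x'‖ := by
      refine Tendsto.congr' ?_ (hconv _ hs' hx1')
      filter_upwards [eventually_ne_atTop 0] with n hn
      rw [hc, Function.update_of_ne hn]
    have hcj : c j = e j := Function.update_of_ne hj.ne' _ _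
    have hc0 : ‖c 0‖ = ‖w‖ := by rw [hc, Function.update_self, norm_sub_eq_right hw]
    obtain ⟨n, hn⟩ := exists_isDominant hs' hcc ⟨j, by rw [hcj]; exact norm_pos_iff.1 hej⟩
    have hn0 : 0 < n := by
      rw [Nat.pos_iff_ne_zero]
      rintro rfl
      have := hn.le j
      rw [hcj, hc0, pow_zero, mul_one] at this
      linarith
    obtain ⟨t, ht, ht0⟩ := exists_zero hs' hcc hn0 hn
    have ht1 := ht.trans_lt hx1'
    have hval : g ⟨a + t, DiscMorphism.norm_add_lt_one a ht1⟩ = w := by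
      rw [he]
      simp only [add_sub_cancel_left]
      rw [eval_eq_add hcc ht] at ht0
      rw [eval_eq_add (hconv _ hs' hx1') ht]
      have : (fun i => c (i + 1)) = fun i => e (i + 1) := by
        ext i
        simp [hc]
      rw [this, hc, Function.update_self] at ht0
      linear_combination ht0
    have := hmax ⟨a + t, DiscMorphism.norm_add_lt_one a ht1⟩
    rw [hval, hga] at this
    linarith

end NonarchSeries

namespace DiscMorphism

open NonarchSeries

/-- The number of points of the fiber through `a` that lie in `D(a,s⁻)`, as the limit of
`localDegree F a t` when `t` tends to `s` from the left. -/
def leftDegree (F : DiscMorphism k) (a : UnitDisc k) (s : ℝ) : ℕ :=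
  sSup {n | ∃ t, 0 < t ∧ t < s ∧ F.localDegree a t = n}

theorem localDegree_le_leftDegree {F : DiscMorphism k} (het : F.Etale) (a : UnitDisc k)
    {s t : ℝ} (ht : 0 < t) (hts : t < s) : F.localDegree a t ≤ F.leftDegree a s := by
  refine le_csSup ⟨F.degree, ?_⟩ ⟨t, ht, hts, rfl⟩
  rintro n ⟨t, -, -, rfl⟩
  exact localDegree_le het a t

theorem exists_localDegree_eq_leftDegree {F : DiscMorphism k} (het : F.Etale) (a : UnitDisc k)
    {s : ℝ} (hs : 0 < s) :
    ∃ s₀, 0 < s₀ ∧ s₀ < s ∧ ∀ t, s₀ ≤ t → t < s → F.localDegree a t = F.leftDegree a s := by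
  have hmem : F.leftDegree a s ∈ {n | ∃ t, 0 < t ∧ t < s ∧ F.localDegree a t = n} := by
    refine Nat.sSup_mem ⟨_, s / 2, half_pos hs, half_lt_self hs, rfl⟩ ⟨F.degree, ?_⟩
    rintro n ⟨t, -, -, rfl⟩
    exact localDegree_le het a t
  obtain ⟨s₀, h0, hlt, heq⟩ := hmem
  exact ⟨s₀, h0, hlt, fun t ht hts => le_antisymm
    (localDegree_le_leftDegree het a (h0.trans_le ht) hts) (heq ▸ localDegree_mono het a ht)⟩

theorem eventually_localDegree_eq_right {F : DiscMorphism k} (het : F.Etale)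
    (a : UnitDisc k) (s : ℝ) :
    ∀ᶠ t in 𝓝[>] s, F.localDegree a t = F.localDegree a s := by
  obtain ⟨S, hS, -⟩ := exists_fiber het (F.toFun a)
  have h : ∀ᶠ t in 𝓝[>] s, ∀ b ∈ S, ‖(b : k) - a‖ ≤ t → ‖(b : k) - a‖ ≤ s := by
    rw [Filter.eventually_all_finset]
    intro b _
    rcases le_or_gt ‖(b : k) - a‖ s with hb | hb
    · exact Eventually.of_forall fun _ _ => hb
    · filter_upwards [Ioo_mem_nhdsGT hb] with t ht htb
      exact absurd htb (not_le.2 ht.2)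
  filter_upwards [h, self_mem_nhdsWithin] with t ht hst
  rw [localDegree, localDegree]
  congr 1
  ext b
  exact ⟨fun hb => ⟨hb.1, ht b ((hS b).2 hb.1) hb.2⟩, fun hb => ⟨hb.1, hb.2.trans (le_of_lt hst)⟩⟩

section Etale

variable [IsUltrametricDist k] [IsAlgClosed k] [CompleteSpace k]
variable {F : DiscMorphism k}

theorem leftDegree_pos (het : F.Etale) (a : UnitDisc k) {s : ℝ} (hs : 0 < s) (hs1 : s ≤ 1) :
    0 < F.leftDegree a s :=
  (localDegree_pos het a (half_pos hs) ((half_lt_self hs).trans_le hs1)).trans_le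
    (localDegree_le_leftDegree het a (half_pos hs) (half_lt_self hs))

theorem profile_eq_of_localDegree_eq (het : F.Etale) (a : UnitDisc k) {s₀ s : ℝ} {q : ℕ}
    (h0 : 0 < s₀)
    (hlt : s₀ < s) (hs1 : s ≤ 1) (hq : ∀ t, s₀ ≤ t → t < s → F.localDegree a t = q) {t : ℝ}
    (ht : s₀ ≤ t) (hts : t ≤ s) : F.profile a t = ‖F.coeff a q‖ * t ^ q := by
  have key : ∀ t, s₀ ≤ t → t < s → F.profile a t = ‖F.coeff a q‖ * t ^ q := fun t ht hts => by
    rw [profile_eq het a (h0.trans_le ht) (hts.trans_le hs1), hq t ht hts]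
  rcases hts.lt_or_eq with hts | rfl
  · exact key t ht hts
  have hIco : Ico s₀ t ∈ 𝓝[<] t := Ico_mem_nhdsLT hlt
  have h1 : Tendsto (F.profile a) (𝓝[<] t) (𝓝 (F.profile a t)) := by
    refine (profile_continuousOn het a t ⟨(h0.trans hlt).le, hs1⟩).mono_left ?_
    refine nhdsWithin_le_of_mem ?_
    filter_upwards [hIco] with u hu
    exact ⟨h0.le.trans hu.1, hu.2.le.trans hs1⟩
  have h2 : Tendsto (fun u : ℝ => ‖F.coeff a q‖ * u ^ q) (𝓝[<] t) (𝓝 (‖F.coeff a q‖ * t ^ q)) :=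
    (Continuous.tendsto (by fun_prop) t).mono_left nhdsWithin_le_nhds
  refine tendsto_nhds_unique (h1.congr' ?_) h2
  filter_upwards [hIco] with u hu
  exact key u hu.1 hu.2

theorem profile_eq_mul_pow (het : F.Etale) (a : UnitDisc k) {s₀ s : ℝ} {q : ℕ} (h0 : 0 < s₀)
    (hlt : s₀ < s) (hs1 : s ≤ 1) (hq : ∀ t, s₀ ≤ t → t < s → F.localDegree a t = q) {t : ℝ}
    (ht : s₀ ≤ t) (hts : t ≤ s) : F.profile a t = F.profile a s * (t / s) ^ q := by
  have hs : 0 < s := h0.trans hlt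
  rw [profile_eq_of_localDegree_eq het a h0 hlt hs1 hq ht hts,
    profile_eq_of_localDegree_eq het a h0 hlt hs1 hq hlt.le le_rfl, div_pow]
  field_simp

theorem profile_eq_leftDegree (het : F.Etale) (a : UnitDisc k) {s : ℝ} (hs : 0 < s) (hs1 : s ≤ 1) :
    F.profile a s = ‖F.coeff a (F.leftDegree a s)‖ * s ^ F.leftDegree a s := by
  obtain ⟨s₀, h0, hlt, hq⟩ := exists_localDegree_eq_leftDegree het a hs
  exact profile_eq_of_localDegree_eq het a h0 hlt hs1 hq hlt.le le_rfl

theorem norm_coeff_mul_lt (het : F.Etale) (a : UnitDisc k) {s : ℝ} (hs : 0 < s) (hs1 : s ≤ 1)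
    {i : ℕ}
    (hi : i < F.leftDegree a s) : ‖F.coeff a i‖ * s ^ i < F.profile a s := by
  obtain ⟨s₀, h0, hlt, hq⟩ := exists_localDegree_eq_leftDegree het a hs
  have h1 := norm_coeff_mul_le het a h0 (hlt.le.trans hs1) i
  have h2 := profile_pos het a h0 (hlt.le.trans hs1)
  have h3 := profile_eq_mul_pow het a h0 hlt hs1 hq le_rfl hlt.le
  calc ‖F.coeff a i‖ * s ^ i = ‖F.coeff a i‖ * s₀ ^ i * (s / s₀) ^ i := by
        rw [div_pow]; field_simp
    _ ≤ F.profile a s₀ * (s / s₀) ^ i := by gcongr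
    _ < F.profile a s₀ * (s / s₀) ^ F.leftDegree a s := by
        gcongr
        exact (one_lt_div h0).2 hlt
    _ = F.profile a s := by
        rw [h3, mul_assoc, ← mul_pow]
        field_simp
        simp

theorem leftDegree_eq_of_profile_eq (het : F.Etale) {s : ℝ} (hs : 0 < s) (hs1 : s ≤ 1)
    (h : ∀ a b, F.profile a s = F.profile b s) (a b : UnitDisc k) :
    F.leftDegree a s = F.leftDegree b s := by
  have : Nonempty (UnitDisc k) := ⟨a⟩
  set c := Function.argmin (fun a => F.leftDegree a s) with hc
  have hmin : ∀ a, F.leftDegree c s ≤ F.leftDegree a s := fun a =>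
    Function.argmin_le (fun a => F.leftDegree a s) a
  suffices hsuff : ∀ a, F.leftDegree a s ≤ F.leftDegree c s by
    rw [le_antisymm (hsuff a) (hmin a), le_antisymm (hsuff b) (hmin b)]
  intro a
  by_contra! hlt
  have hspos := pow_pos hs (F.leftDegree c s)
  obtain ⟨e, he⟩ := F.exists_hasSum_coeff (leftDegree_pos het c hs hs1).ne' c
  have hle : ∀ b, ‖F.coeff b (F.leftDegree c s)‖ ≤ ‖F.coeff c (F.leftDegree c s)‖ := fun b => by
    have := norm_coeff_mul_le het b hs hs1 (F.leftDegree c s)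
    rw [h b c, profile_eq_leftDegree het c hs hs1] at this
    exact le_of_mul_le_mul_right this hspos
  have hne : F.coeff c (F.leftDegree c s) ≠ 0 := by
    intro h0
    have := profile_pos het c hs hs1
    rw [profile_eq_leftDegree het c hs hs1, h0] at this
    simp at this
  have heq := norm_eq_of_forall_norm_le (g := fun b => F.coeff b (F.leftDegree c s)) he hne hle a
  have := norm_coeff_mul_lt het a hs hs1 hlt
  rw [heq, ← profile_eq_leftDegree het c hs hs1, h c a] at this
  exact lt_irrefl _ this

theorem localDegree_eq_of_profile_eq (het : F.Etale) {a b : UnitDisc k}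
    (h : ∀ s, F.profile a s = F.profile b s)
    {s : ℝ} (hs : 0 < s) (hs1 : s < 1) : F.localDegree a s = F.localDegree b s := by
  obtain ⟨t, hta, htb, hst, ht1⟩ := ((eventually_localDegree_eq_right het a s).and
    ((eventually_localDegree_eq_right het b s).and (Ioo_mem_nhdsGT hs1))).exists
  have ht : 0 < t := hs.trans hst
  have hgrow : ∀ c, F.localDegree c t = F.localDegree c s →
      F.profile c t = F.profile c s * (t / s) ^ F.localDegree c s := fun c hc => by
    rw [profile_eq het c ht ht1, profile_eq het c hs hs1, hc, div_pow]
    field_simp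
  have heq := hgrow a hta
  rw [h, h, hgrow b htb] at heq
  exact (pow_right_injective₀ (div_pos ht hs) ((one_lt_div hs).2 hst).ne'
    (mul_left_cancel₀ (profile_pos het b hs hs1.le).ne' heq)).symm

theorem closedDisc_eq_iff (het : F.Etale) {ρ : ℝ} {σ : UnitDisc k → ℝ}
    (hσ : ∀ b, 0 < σ b ∧ σ b < 1 ∧ F.profile b (σ b) = ρ) (b t : UnitDisc k) :
    closedDisc (t : k) (σ t) = closedDisc (b : k) (σ b) ↔ ‖(t : k) - b‖ ≤ σ b := by
  constructor
  · intro h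
    have : (t : k) ∈ closedDisc (t : k) (σ t) := by simpa [closedDisc] using (hσ t).1.le
    rw [h] at this
    exact this
  · intro h
    have hp := profile_eq_of_mem het (hσ b).1 (hσ b).2.1 h
    rw [(hσ b).2.2, ← (hσ t).2.2] at hp
    have hst : σ t = σ b := (profile_injOn het t ⟨(hσ b).1.le, (hσ b).2.1.le⟩
      ⟨(hσ t).1.le, (hσ t).2.1.le⟩ hp).symm
    ext x
    rw [hst]
    constructor
    · intro hx
      change ‖x - b‖ ≤ σ b
      rw [← sub_add_sub_cancel x (t : k) b]
      exact (IsUltrametricDist.norm_add_le_max _ _).trans (max_le hx h)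
    · intro hx
      change ‖x - t‖ ≤ σ b
      rw [← sub_sub_sub_cancel_right x (t : k) b]
      exact (norm_sub_le_max _ _).trans (max_le hx h)

theorem fiberCount_eq_sum (het : F.Etale) {ρ : ℝ} (hρ : 0 < ρ) {σ : UnitDisc k → ℝ}
    (hσ : ∀ b, 0 < σ b ∧ σ b < 1 ∧ F.profile b (σ b) = ρ) {y : UnitDisc k}
    {S : Finset (UnitDisc k)} (hS : ∀ b, b ∈ S ↔ F.toFun b = y) :
    (F.fiberCount y ρ : ℚ) = ∑ b ∈ S, (1 / F.localDegree b (σ b) : ℚ) := by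
  classical
  set φ : UnitDisc k → Set k := fun b => closedDisc (b : k) (σ b) with hφ
  have hiff : ∀ b t, φ t = φ b ↔ ‖(t : k) - b‖ ≤ σ b := closedDisc_eq_iff het hσ
  have hset : {D : Set k | ∃ (b : UnitDisc k) (s : ℝ), 0 ≤ s ∧ s < 1 ∧
      F.profile b s = ρ ∧ ‖(F.toFun b : k) - (y : k)‖ ≤ ρ ∧ D = closedDisc (b : k) s} =
      (S.image φ : Set (Set k)) := by
    ext D
    simp only [mem_ofPred_eq, Finset.coe_image, mem_image, Finset.mem_coe, hS]
    constructor
    · rintro ⟨b, s, hs, hs1, hp, hy, rfl⟩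
      have hs0 : 0 < s := by
        rcases hs.lt_or_eq with h | rfl
        · exact h
        · rw [profile_zero] at hp
          exact absurd hp hρ.ne
      have hsσ : s = σ b := profile_injOn het b ⟨hs, hs1.le⟩ ⟨(hσ b).1.le, (hσ b).2.1.le⟩
        (hp.trans (hσ b).2.2.symm)
      obtain ⟨t, ht, hty⟩ := exists_preimage het b hs0 hs1 (y := (y : k))
        (by rwa [hp, norm_sub_rev])
      refine ⟨t, Subtype.ext hty, ?_⟩
      rw [hsσ] at ht ⊢
      exact (hiff b t).2 ht
    · rintro ⟨b, hb, rfl⟩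
      exact ⟨b, σ b, (hσ b).1.le, (hσ b).2.1, (hσ b).2.2, by simp [hb, hρ.le], rfl⟩
  rw [fiberCount, hset, Set.ncard_coe_finset,
    ← Finset.sum_fiberwise_of_maps_to (fun b hb => Finset.mem_image_of_mem φ hb),
    Finset.card_eq_sum_ones, Nat.cast_sum]
  refine Finset.sum_congr rfl fun D hD => ?_
  obtain ⟨b, hb, rfl⟩ := Finset.mem_image.1 hD
  have hcard : ∀ t ∈ S.filter (fun t => φ t = φ b),
      F.localDegree t (σ t) = (S.filter fun t => φ t = φ b).card := by
    intro t ht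
    rw [Finset.mem_filter] at ht
    rw [localDegree, ← Set.ncard_coe_finset]
    congr 1
    ext u
    simp only [mem_ofPred_eq, Finset.coe_filter, ← ht.2, hiff, hS, (hS t).1 ht.1]
  have hne : (S.filter fun t => φ t = φ b).Nonempty := ⟨b, Finset.mem_filter.2 ⟨hb, rfl⟩⟩
  rw [Finset.sum_congr rfl fun t ht => by rw [hcard t ht], Finset.sum_const, nsmul_eq_mul,
    mul_one_div, div_self (by exact_mod_cast hne.card_pos.ne'), Nat.cast_one]

theorem fiberCount_zero (het : F.Etale) (y : UnitDisc k) : F.fiberCount y 0 = F.degree := by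
  classical
  obtain ⟨S, hS, hcard⟩ := exists_fiber het y
  have hdisc : ∀ b : k, closedDisc b 0 = {b} := fun b => by
    ext x
    simp [closedDisc, sub_eq_zero]
  have hinj : Function.Injective fun b : UnitDisc k => ({(b : k)} : Set k) := fun b b' h =>
    Subtype.ext (singleton_injective h)
  rw [← hcard, ← Finset.card_image_of_injective S hinj, ← Set.ncard_coe_finset, fiberCount]
  congr 1
  ext D
  simp only [mem_ofPred_eq, Finset.coe_image, mem_image, Finset.mem_coe, hS]
  constructor
  · rintro ⟨b, s, hs, hs1, hp, hy, rfl⟩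
    obtain rfl : s = 0 := profile_injOn het b ⟨hs, hs1.le⟩ (left_mem_Icc.2 zero_le_one)
      (hp.trans (F.profile_zero b).symm)
    exact ⟨b, Subtype.ext (sub_eq_zero.1 (norm_le_zero_iff.1 hy)), (hdisc b).symm⟩
  · rintro ⟨b, hb, rfl⟩
    exact ⟨b, 0, le_rfl, one_pos, F.profile_zero b, by simp [hb], (hdisc b).symm⟩

end Etale

end DiscMorphism

theorem Ioc_subset_of_eventually_left {A : Set ℝ} (hA : IsClosed (A ∩ Icc 0 1)) (h1 : 1 ∈ A)
    (hleft : ∀ s ∈ A, 0 < s → s ≤ 1 → ∀ᶠ t in 𝓝[<] s, t ∈ A) : Ioc 0 1 ⊆ A := by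
  rintro x ⟨hx0, hx1⟩
  have hcont : Continuous fun t : ℝ => 1 - t := by fun_prop
  have key : Icc 0 (1 - x) ⊆ Set.preimage (fun t : ℝ => 1 - t) A := by
    refine IsClosed.Icc_subset_of_forall_exists_gt ?_ (by simpa using h1) ?_
    · have : Set.preimage (fun t : ℝ => 1 - t) A ∩ Icc 0 (1 - x) =
          Set.preimage (fun t : ℝ => 1 - t) (A ∩ Icc 0 1) ∩ Icc 0 (1 - x) := by
        ext t
        simp only [mem_inter_iff, mem_preimage, mem_Icc]
        constructor
        · rintro ⟨h, h0, hx⟩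
          exact ⟨⟨h, by linarith, by linarith⟩, h0, hx⟩
        · rintro ⟨⟨h, -, -⟩, h0, hx⟩
          exact ⟨h, h0, hx⟩
      rw [this]
      exact (hA.preimage hcont).inter isClosed_Icc
    · rintro t ⟨ht, ht0, htx⟩ z hz
      have hlt : 1 - z < 1 - t := by linarith [mem_Ioi.1 hz]
      obtain ⟨u, hu, huz, hut⟩ := ((hleft (1 - t) ht (by linarith) (by linarith)).and
        (Ico_mem_nhdsLT hlt)).exists
      exact ⟨1 - u, by simpa using hu, by linarith, by linarith⟩
  simpa using key (right_mem_Icc.2 (by linarith))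

namespace DiscMorphism

theorem radial_iff_profile_eq (F : DiscMorphism k) :
    F.Radial ↔ ∀ a b s, F.profile a s = F.profile b s := by
  constructor
  · intro h a b s
    rw [profile, profile]
    split_ifs with h0 h1
    · rfl
    · rfl
    · rw [h a b _ (neg_pos.2 (Real.log_neg (not_le.1 h0) (not_le.1 h1)))]
  · intro h a b lam hlam
    have := h a b (Real.exp (-lam))
    rw [profile, profile, if_neg (not_le.2 (Real.exp_pos _)),
      if_neg (not_le.2 (Real.exp_lt_one_iff.2 (by linarith))),
      if_neg (not_le.2 (Real.exp_pos _)),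
      if_neg (not_le.2 (Real.exp_lt_one_iff.2 (by linarith))), Real.log_exp, neg_neg] at this
    exact neg_injective (Real.exp_injective this)

section Etale

variable [IsUltrametricDist k] [IsAlgClosed k] [CompleteSpace k]
variable {F : DiscMorphism k}

theorem exists_sections (het : F.Etale) {ρ : ℝ} (hρ : 0 < ρ) (hρ1 : ρ < 1) :
    ∃ σ : UnitDisc k → ℝ, ∀ b, 0 < σ b ∧ σ b < 1 ∧ F.profile b (σ b) = ρ := by
  choose σ hσ using fun b => exists_profile_eq het b hρ hρ1
  exact ⟨σ, hσ⟩

theorem fiberCount_eq_div (het : F.Etale) {ρ : ℝ} (hρ : 0 < ρ) (hρ1 : ρ < 1) {q : ℕ}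
    {y : UnitDisc k}
    (hq : ∀ b s, F.toFun b = y → 0 < s → s < 1 → F.profile b s = ρ → F.localDegree b s = q) :
    (F.fiberCount y ρ : ℚ) = F.degree / q := by
  obtain ⟨σ, hσ⟩ := exists_sections het hρ hρ1
  obtain ⟨S, hS, hcard⟩ := exists_fiber het y
  rw [fiberCount_eq_sum het hρ hσ hS, Finset.sum_congr rfl fun b hb => by
    rw [hq b (σ b) ((hS b).1 hb) (hσ b).1 (hσ b).2.1 (hσ b).2.2], Finset.sum_const, hcard,
    nsmul_eq_mul, mul_one_div]

theorem localDegree_eq_of_fiberCount_eq (het : F.Etale) {ρ : ℝ} (hρ : 0 < ρ) (hρ1 : ρ < 1) {q : ℕ}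
    (hle : ∀ b s, 0 < s → s < 1 → F.profile b s = ρ → F.localDegree b s ≤ q)
    {b : UnitDisc k} (hcount : (F.fiberCount (F.toFun b) ρ : ℚ) = F.degree / q) {s : ℝ}
    (hs : 0 < s) (hs1 : s < 1) (hp : F.profile b s = ρ) : F.localDegree b s = q := by
  obtain ⟨σ, hσ⟩ := exists_sections het hρ hρ1
  obtain ⟨S, hS, hcard⟩ := exists_fiber het (F.toFun b)
  have hsσ : s = σ b := profile_injOn het b ⟨hs.le, hs1.le⟩ ⟨(hσ b).1.le, (hσ b).2.1.le⟩
    (hp.trans (hσ b).2.2.symm)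
  have hpos : ∀ t, (0 : ℚ) < F.localDegree t (σ t) := fun t => by
    exact_mod_cast localDegree_pos het t (hσ t).1 (hσ t).2.1
  have hterm : ∀ t ∈ S, (1 / q : ℚ) ≤ 1 / F.localDegree t (σ t) := fun t _ =>
    one_div_le_one_div_of_le (hpos t)
      (by exact_mod_cast hle t (σ t) (hσ t).1 (hσ t).2.1 (hσ t).2.2)
  rw [fiberCount_eq_sum het hρ hσ hS] at hcount
  have hsum : ∑ t ∈ S, (1 / q : ℚ) = ∑ t ∈ S, (1 / F.localDegree t (σ t) : ℚ) := by
    rw [hcount, Finset.sum_const, hcard, nsmul_eq_mul, mul_one_div]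
  have h := (Finset.sum_eq_sum_iff_of_le hterm).1 hsum b ((hS b).2 rfl)
  rw [one_div, one_div, inv_inj] at h
  rw [hsσ]
  exact_mod_cast h.symm

theorem eventually_fiberCount_eq_div (het : F.Etale) {s ρ : ℝ} (hs : 0 < s) (hs1 : s ≤ 1) {q : ℕ}
    (hρ : ∀ a, F.profile a s = ρ) (hq : ∀ a, F.leftDegree a s = q) (y : UnitDisc k) :
    ∀ᶠ r in 𝓝[<] ρ, (F.fiberCount y r : ℚ) = F.degree / q := by
  obtain ⟨S, hS, -⟩ := exists_fiber het y
  have hρ0 : 0 < ρ := hρ y ▸ profile_pos het y hs hs1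
  have hρ1 : ρ ≤ 1 := by
    rw [← hρ y, ← F.profile_one y]
    exact profile_mono het y hs hs1 le_rfl
  have h : ∀ᶠ r in 𝓝[<] ρ, ∀ b ∈ S, ∀ t, 0 < t → t < 1 → F.profile b t = r →
      F.localDegree b t = q := by
    rw [Filter.eventually_all_finset]
    intro b _
    obtain ⟨s₀, h0, hlt, hs₀⟩ := exists_localDegree_eq_leftDegree het b hs
    have hmono := profile_strictMonoOn het b
    have hmem0 : s₀ ∈ Icc (0 : ℝ) 1 := ⟨h0.le, hlt.le.trans hs1⟩
    have hmem : s ∈ Icc (0 : ℝ) 1 := ⟨hs.le, hs1⟩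
    have hρlt : F.profile b s₀ < ρ := hρ b ▸ hmono hmem0 hmem hlt
    filter_upwards [Ico_mem_nhdsLT hρlt] with r hr t ht ht1 hp
    have hmemt : t ∈ Icc (0 : ℝ) 1 := ⟨ht.le, ht1.le⟩
    rw [← hq b]
    refine hs₀ t ((hmono.le_iff_le hmem0 hmemt).1 (hp ▸ hr.1)) ?_
    refine (hmono.lt_iff_lt hmemt hmem).1 ?_
    rw [hp, hρ b]
    exact hr.2
  filter_upwards [h, Ioo_mem_nhdsLT hρ0] with r hr hr0
  exact fiberCount_eq_div het hr0.1 (hr0.2.trans_le hρ1)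
    fun b t hb => hr b ((hS b).2 hb) t

theorem fiberCount_eq_of_radial (het : F.Etale) (hF : ∀ a b s, F.profile a s = F.profile b s)
    (y z : UnitDisc k) {ρ : ℝ} (hρ : ρ ∈ Ico (0 : ℝ) 1) : F.fiberCount y ρ = F.fiberCount z ρ := by
  rcases hρ.1.lt_or_eq with h0 | rfl
  swap
  · rw [fiberCount_zero het, fiberCount_zero het]
  obtain ⟨s, hs, hs1, hp⟩ := exists_profile_eq het y h0 hρ.2
  have key : ∀ x, (F.fiberCount x ρ : ℚ) = F.degree / F.localDegree y s := fun x => by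
    refine fiberCount_eq_div het h0 hρ.2 fun b t _ ht ht1 hbt => ?_
    have hts : t = s := profile_injOn het b ⟨ht.le, ht1.le⟩ ⟨hs.le, hs1.le⟩
      (by rw [hbt, hF b y, hp])
    rw [hts]
    exact localDegree_eq_of_profile_eq het (hF b y) hs hs1
  exact_mod_cast (key y).trans (key z).symm

theorem eventually_profile_eq (het : F.Etale) {s : ℝ} (hs : 0 < s) (hs1 : s ≤ 1)
    (hcount : ∀ y z ρ, ρ ∈ Ico (0 : ℝ) 1 → F.fiberCount y ρ = F.fiberCount z ρ)
    (hp : ∀ a b, F.profile a s = F.profile b s) :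
    ∀ᶠ t in 𝓝[<] s, ∀ a b, F.profile a t = F.profile b t := by
  let o : UnitDisc k := ⟨0, by simp⟩
  set ρ := F.profile o s with hρ
  set q := F.leftDegree o s with hq
  have hpρ : ∀ a, F.profile a s = ρ := fun a => hp a o
  have hql : ∀ a, F.leftDegree a s = q := fun a => leftDegree_eq_of_profile_eq het hs hs1 hp a o
  have hq0 : q ≠ 0 := (leftDegree_pos het o hs hs1).ne'
  have hρ0 : 0 < ρ := profile_pos het o hs hs1
  have hρ1 : ρ ≤ 1 := by
    rw [← F.profile_one o]
    exact profile_mono het o hs hs1 le_rfl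
  have hmem : s ∈ Icc (0 : ℝ) 1 := ⟨hs.le, hs1⟩
  obtain ⟨r, hrρ, hr⟩ := (mem_nhdsLT_iff_exists_Ioo_subset' hρ0).1
    ((eventually_fiberCount_eq_div het hs hs1 hpρ hql o).and (Ioo_mem_nhdsLT hρ0))
  obtain ⟨r', hrr', hr'ρ⟩ := exists_between (mem_Iio.1 hrρ)
  have hr'0 : 0 < r' := (hr ⟨hrr', hr'ρ⟩).2.1
  have hloc : ∀ b t, 0 < t → t < s → r' ≤ F.profile b t → F.localDegree b t = q := by
    intro b t ht hts hbt
    have ht1 := hts.trans_le hs1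
    have hlt : F.profile b t < ρ :=
      hpρ b ▸ profile_strictMonoOn het b ⟨ht.le, ht1.le⟩ hmem hts
    have hlt1 := hlt.trans_le hρ1
    have hpos := hr'0.trans_le hbt
    refine localDegree_eq_of_fiberCount_eq het hpos hlt1 ?_ ?_ ht ht1 rfl
    · intro c u hu hu1 hcu
      rw [← hql c]
      refine localDegree_le_leftDegree het c hu ?_
      refine ((profile_strictMonoOn het c).lt_iff_lt ⟨hu.le, hu1.le⟩ hmem).1 ?_
      rwa [hcu, hpρ c]
    · rw [hcount _ o _ ⟨hpos.le, hlt1⟩]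
      exact (hr ⟨hrr'.trans_le hbt, hlt⟩).1
  obtain ⟨σ, hσ⟩ := exists_sections het hr'0 (hr'ρ.trans_le hρ1)
  have hσs : ∀ b, σ b < s := fun b =>
    ((profile_strictMonoOn het b).lt_iff_lt ⟨(hσ b).1.le, (hσ b).2.1.le⟩ hmem).1
      (by rwa [(hσ b).2.2, hpρ b])
  have hform : ∀ b t, σ b ≤ t → t ≤ s → F.profile b t = ρ * (t / s) ^ q := by
    intro b t hbt hts
    rw [← hpρ b]
    refine profile_eq_mul_pow het b (hσ b).1 (hσs b) hs1 (fun u hu hus => ?_) hbt hts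
    refine hloc b u ((hσ b).1.trans_le hu) hus ?_
    rw [← (hσ b).2.2]
    exact profile_mono het b (hσ b).1 hu (hus.le.trans hs1)
  have hσo : ∀ b, σ b = σ o := by
    intro b
    have h1 := hform b (σ b) le_rfl (hσs b).le
    have h2 := hform o (σ o) le_rfl (hσs o).le
    rw [(hσ b).2.2] at h1
    rw [(hσ o).2.2, h1] at h2
    have h3 := (pow_left_inj₀ (div_pos (hσ b).1 hs).le (div_pos (hσ o).1 hs).le hq0).1
      (mul_left_cancel₀ hρ0.ne' h2)
    exact (div_left_inj' hs.ne').1 h3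
  filter_upwards [Ico_mem_nhdsLT (hσs o)] with t ht a b
  rw [hform a t (hσo a ▸ ht.1) ht.2.le, hform b t (hσo b ▸ ht.1) ht.2.le]

theorem isClosed_profile_eq (het : F.Etale) {G : DiscMorphism k} (hG : G.Etale) (a b : UnitDisc k) :
    IsClosed ({s | F.profile a s = G.profile b s} ∩ Icc 0 1) := by
  have h := ((profile_continuousOn het a).sub
    (profile_continuousOn hG b)).preimage_isClosed_of_isClosed isClosed_Icc
    (isClosed_singleton (x := (0 : ℝ)))
  convert h using 1
  ext s
  simp [sub_eq_zero, and_comm]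

theorem profile_eq_of_fiberCount_eq (het : F.Etale)
    (hcount : ∀ y z ρ, ρ ∈ Ico (0 : ℝ) 1 → F.fiberCount y ρ = F.fiberCount z ρ)
    (a b : UnitDisc k) (s : ℝ) : F.profile a s = F.profile b s := by
  have hsub : Ioc (0 : ℝ) 1 ⊆ {s | ∀ a b, F.profile a s = F.profile b s} := by
    refine Ioc_subset_of_eventually_left ?_ (fun a b => by rw [profile_one, profile_one])
      fun s hs h0 h1 => eventually_profile_eq het h0 h1 hcount hs
    have : {s | ∀ a b, F.profile a s = F.profile b s} ∩ Icc 0 1 =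
        ⋂ (a : UnitDisc k) (b : UnitDisc k), {s | F.profile a s = F.profile b s} ∩ Icc 0 1 := by
      have : Nonempty (UnitDisc k) := ⟨a⟩
      ext s
      simp only [mem_inter_iff, mem_iInter, mem_ofPred_eq]
      exact ⟨fun h a b => ⟨h.1 a b, h.2⟩, fun h => ⟨fun a b => (h a b).1, (h a a).2⟩⟩
    rw [this]
    exact isClosed_iInter fun a => isClosed_iInter fun b => isClosed_profile_eq het het a b
  rcases le_or_gt s 0 with h0 | h0
  · rw [profile, profile, if_pos h0, if_pos h0]
  rcases le_or_gt s 1 with h1 | h1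
  · exact hsub ⟨h0, h1⟩ a b
  · rw [profile, profile, if_neg (not_le.2 h0), if_neg (not_le.2 h0), if_pos h1.le, if_pos h1.le]

theorem profile_unique (het : F.Etale) {G : DiscMorphism k} (hG : G.Etale)
    (hFr : ∀ a b s, F.profile a s = F.profile b s) (hGr : ∀ a b s, G.profile a s = G.profile b s)
    (hcount : ∀ y z ρ, ρ ∈ Ico (0 : ℝ) 1 → F.fiberCount y ρ = G.fiberCount z ρ)
    (a b : UnitDisc k) (s : ℝ) : F.profile a s = G.profile b s := by
  have hdeg : F.degree = G.degree := by
    rw [← fiberCount_zero het a, ← fiberCount_zero hG a]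
    exact hcount a a 0 ⟨le_rfl, one_pos⟩
  have hsub : Ioc (0 : ℝ) 1 ⊆ {s | F.profile a s = G.profile b s} := by
    refine Ioc_subset_of_eventually_left (isClosed_profile_eq het hG a b)
      (by rw [mem_ofPred_eq, profile_one, profile_one]) fun s hs h0 h1 => ?_
    have hs : F.profile a s = G.profile b s := hs
    have hFq := fun c => leftDegree_eq_of_profile_eq het h0 h1 (fun a b => hFr a b s) c a
    have hGq := fun c => leftDegree_eq_of_profile_eq hG h0 h1 (fun a b => hGr a b s) c b
    have hρ0 := profile_pos het a h0 h1
    have hρ1 : F.profile a s ≤ 1 := by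
      rw [← F.profile_one a]
      exact profile_mono het a h0 h1 le_rfl
    obtain ⟨r, hrF, hrG, hr⟩ := ((eventually_fiberCount_eq_div het h0 h1 (fun c => hFr c a s)
      hFq a).and ((eventually_fiberCount_eq_div hG h0 h1 (fun c => (hGr c b s).trans hs.symm)
        hGq b).and (Ioo_mem_nhdsLT hρ0))).exists
    rw [hcount a b r ⟨hr.1.le, hr.2.trans_le hρ1⟩, hrG, hdeg] at hrF
    have hq : F.leftDegree a s = G.leftDegree b s := by
      have hd : (G.degree : ℚ) ≠ 0 := by exact_mod_cast G.degree_pos.ne'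
      rw [div_eq_mul_inv, div_eq_mul_inv] at hrF
      exact_mod_cast (inv_injective (mul_left_cancel₀ hd hrF)).symm
    obtain ⟨sF, hF0, hFs, hF⟩ := exists_localDegree_eq_leftDegree het a h0
    obtain ⟨sG, hG0, hGs, hG'⟩ := exists_localDegree_eq_leftDegree hG b h0
    filter_upwards [Ico_mem_nhdsLT hFs, Ico_mem_nhdsLT hGs] with t htF htG
    rw [profile_eq_mul_pow het a hF0 hFs h1 hF htF.1 htF.2.le,
      profile_eq_mul_pow hG b hG0 hGs h1 hG' htG.1 htG.2.le, hs, hq]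
  rcases le_or_gt s 0 with h0 | h0
  · rw [profile, profile, if_pos h0, if_pos h0]
  rcases le_or_gt s 1 with h1 | h1
  · exact hsub ⟨h0, h1⟩
  · rw [profile, profile, if_neg (not_le.2 h0), if_neg (not_le.2 h0), if_pos h1.le, if_pos h1.le]

end Etale

end DiscMorphism

variable {p : ℕ} [Fact p.Prime]
variable [NormedAlgebra ℚ_[p] k] [IsAlgClosed k] [CompleteSpace k]

/-- Theorem 2.14: a finite étale morphism `f : D₁ → D₂` of open unit discs of
degree `d` is radial if and only if there is a function `N : [0,1) → ℕ` such that for every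
rational point `y ∈ D₂(k)` and every `ρ ∈ [0,1)` the number `#f⁻¹(ζ_{y,ρ})` of preimages of
`ζ_{y,ρ}`, counted without multiplicity, equals `N(ρ)`.  Moreover, when `f` is radial, its
profile `𝕡_f` is uniquely determined by the function `N`. -/
theorem radial_iff_fiber_count_radial
    (hk : IsNonarchimedean fun x : k => ‖x‖)
    (F : DiscMorphism k) (d : ℕ) (hd : F.degree = d) (het : F.Etale) :
    (F.Radial ↔ ∃ N : ℝ → ℕ, ∀ (y : UnitDisc k) (ρ : ℝ), ρ ∈ Set.Ico (0:ℝ) 1 →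
        F.fiberCount y ρ = N ρ) ∧
      -- the profile of a radial morphism is uniquely determined by the function `N`:
      ∀ G : DiscMorphism k, G.Etale → F.Radial → G.Radial →
        (∀ (y z : UnitDisc k) (ρ : ℝ), ρ ∈ Set.Ico (0:ℝ) 1 →
          G.fiberCount y ρ = F.fiberCount z ρ) →
        ∀ (a b : UnitDisc k) (ρ : ℝ), G.profile a ρ = F.profile b ρ := by
  have : IsUltrametricDist k := IsUltrametricDist.isUltrametricDist_of_isNonarchimedean_norm hk
  refine ⟨⟨fun hF => ?_, ?_⟩, ?_⟩
  · rw [F.radial_iff_profile_eq] at hF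
    exact ⟨fun ρ => F.fiberCount ⟨0, by simp⟩ ρ, fun y ρ hρ =>
      DiscMorphism.fiberCount_eq_of_radial het hF y _ hρ⟩
  · rintro ⟨N, hN⟩
    rw [F.radial_iff_profile_eq]
    exact DiscMorphism.profile_eq_of_fiberCount_eq het fun y z ρ hρ => by
      rw [hN y ρ hρ, hN z ρ hρ]
  · intro G hG hFr hGr hcount
    rw [DiscMorphism.radial_iff_profile_eq] at hFr hGr
    exact DiscMorphism.profile_unique hG het hGr hFr hcount
end
end

section
/- Every finite morphism f:D₁→D₂ of open unit discs is weakly 1-radial; more precisely, if f has degree d then for every pair of compatible coordinates (T,S) the highest (first) slope of the valuation polygon v_{(T,S)}(f,·) is equal to d, independently of the chosen coordinates and of the center a∈D₁(k). -/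
/-!
Throughout, `k` is a complete, nonarchimedean, nontrivially valued, algebraically closed
field extension of `ℚ_p`, and `v = -log ‖·‖`.
-/

open Set Filter Topology

noncomputable section

variable (k : Type*) [NontriviallyNormedField k]

variable {k}

/-! ### Convergent power series on the open unit disc -/

/-- The power series `u` converges on the open unit disc. -/
def ConvergesOnDisc (u : PowerSeries k) : Prop :=
  ∀ r : ℝ, 0 ≤ r → r < 1 → Tendsto (fun i => ‖u.coeff i‖ * r ^ i) atTop (𝓝 0)

/-- The value at `x` of the power series `u`. -/
def discEval (u : PowerSeries k) (x : k) : k := ∑' i, u.coeff i * x ^ i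

/-- The `n`-th term of `u` is the unique term of maximal norm on the circle of radius `r`. -/
def StrictlyDominant (u : PowerSeries k) (r : ℝ) (n : ℕ) : Prop :=
  ∀ i, i ≠ n → ‖u.coeff i‖ * r ^ i < ‖u.coeff n‖ * r ^ n

section Polynomial

open Polynomial

variable [IsUltrametricDist k]

lemma norm_coeff_prod_X_sub_C_le {δ : ℝ} (hδ : 0 ≤ δ) (s : Multiset k)
    (hs : ∀ z ∈ s, δ ≤ ‖z‖) (i : ℕ) :
    ‖(s.map fun z => X - C z).prod.coeff i‖ * δ ^ i ≤
      ‖(s.map fun z => X - C z).prod.coeff 0‖ := by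
  induction s using Multiset.induction_on generalizing i with
  | empty => cases i <;> simp [coeff_one]
  | cons z s ih =>
    have ih' := ih fun w hw => hs w (Multiset.mem_cons_of_mem hw)
    have hz := hs z (Multiset.mem_cons_self z s)
    rw [Multiset.map_cons, Multiset.prod_cons]
    cases i with
    | zero => simp
    | succ i =>
      rw [coeff_X_sub_C_mul, mul_coeff_zero]
      generalize (s.map fun z => X - C z).prod = P at ih'
      have h1 : ‖P.coeff i - z * P.coeff (i + 1)‖ ≤
          max ‖P.coeff i‖ ‖z * P.coeff (i + 1)‖ := by
        simpa [sub_eq_add_neg] using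
          IsUltrametricDist.norm_add_le_max (P.coeff i) (-(z * P.coeff (i + 1)))
      have hR : ‖(X - C z).coeff 0 * P.coeff 0‖ = ‖z‖ * ‖P.coeff 0‖ := by simp
      rw [hR]
      refine (mul_le_mul_of_nonneg_right h1 (by positivity)).trans ?_
      rw [max_mul_of_nonneg _ _ (by positivity)]
      refine max_le ?_ ?_
      · rw [pow_succ, ← mul_assoc, mul_comm]
        exact mul_le_mul hz (ih' i) (by positivity) (by positivity)
      · rw [norm_mul, mul_assoc]
        exact mul_le_mul_of_nonneg_left (ih' (i + 1)) (norm_nonneg z)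

/-- A polynomial with nonzero `N`-th coefficient, `N ≥ 1`, has a root as small as
predicted by its Newton polygon. -/
lemma exists_root_norm_pow_le [IsAlgClosed k] (Q : k[X]) {N : ℕ} (hN : 1 ≤ N)
    (hQ : Q.coeff N ≠ 0) :
    ∃ z, Q.eval z = 0 ∧ ‖Q.coeff N‖ * ‖z‖ ^ N ≤ ‖Q.coeff 0‖ := by
  classical
  have hQ0 : Q ≠ 0 := fun h => hQ (by simp [h])
  have hdeg : Q.degree ≠ 0 := by
    intro h
    have := le_natDegree_of_ne_zero hQ
    rw [natDegree_eq_zero_iff_degree_le_zero.2 h.le] at this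
    omega
  obtain ⟨z₀, hz₀⟩ := IsAlgClosed.exists_root Q hdeg
  obtain ⟨z, hz, hmin⟩ := Q.roots.toFinset.exists_min_image (fun z => ‖z‖)
    ⟨z₀, by simpa [hQ0] using hz₀⟩
  refine ⟨z, by simpa [hQ0] using hz, ?_⟩
  have key := norm_coeff_prod_X_sub_C_le (norm_nonneg z) Q.roots
    (fun w hw => hmin w (Multiset.mem_toFinset.2 hw)) N
  have hfac := (IsAlgClosed.splits Q).eq_prod_roots
  have hc : ∀ i, ‖Q.coeff i‖ =
      ‖Q.leadingCoeff‖ * ‖(Q.roots.map fun z => X - C z).prod.coeff i‖ := by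
    intro i
    conv_lhs => rw [hfac]
    rw [coeff_C_mul, norm_mul]
  rw [hc, hc, mul_assoc]
  exact mul_le_mul_of_nonneg_left key (norm_nonneg _)

/-- Recentering a polynomial inside the disc of radius `r` does not change the norm of its
last dominant coefficient on that disc. -/
lemma norm_taylor_coeff_eq {r : ℝ} (hr : 0 < r) (P : k[X]) {N : ℕ} (hPN : P.coeff N ≠ 0)
    (hN : ∀ i, N < i → ‖P.coeff i‖ * r ^ i < ‖P.coeff N‖ * r ^ N) {x : k} (hx : ‖x‖ ≤ r) :
    ‖(taylor x P).coeff N‖ = ‖P.coeff N‖ := by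
  have hlt : ‖∑ i ∈ P.support.erase N, (i.choose N : k) * P.coeff i * x ^ (i - N)‖
      < ‖P.coeff N‖ := by
    rcases (P.support.erase N).eq_empty_or_nonempty with h | h
    · rw [h]; simpa using hPN
    · obtain ⟨i, hi, hle⟩ := IsUltrametricDist.exists_norm_finsetSum_le_of_nonempty h
        (fun i => (i.choose N : k) * P.coeff i * x ^ (i - N))
      refine hle.trans_lt ?_
      rcases lt_or_gt_of_ne (Finset.ne_of_mem_erase hi) with h | h
      · simpa [Nat.choose_eq_zero_of_lt h] using hPN
      · have h1 := hN i h
        have h2 : r ^ i = r ^ (i - N) * r ^ N := by rw [← pow_add, Nat.sub_add_cancel h.le]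
        rw [h2, ← mul_assoc] at h1
        have h3 := lt_of_mul_lt_mul_right h1 (by positivity)
        refine lt_of_le_of_lt ?_ h3
        rw [norm_mul, norm_mul, norm_pow]
        have h4 := IsUltrametricDist.norm_natCast_le_one k (i.choose N)
        have h5 : ‖x‖ ^ (i - N) ≤ r ^ (i - N) := by gcongr
        calc _ ≤ 1 * ‖P.coeff i‖ * r ^ (i - N) := by gcongr
          _ = _ := by ring
  have hsum : (taylor x P).coeff N = P.coeff N +
      ∑ i ∈ P.support.erase N, (i.choose N : k) * P.coeff i * x ^ (i - N) := by
    rw [taylor_coeff, hasseDeriv_apply, sum_def, eval_finsetSum,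
      ← Finset.add_sum_erase _ _ (mem_support_iff.2 hPN)]
    simp
  rw [hsum, add_comm]
  exact IsUltrametricDist.norm_add_eq_max_of_norm_ne_norm hlt.ne ▸ max_eq_right hlt.le

end Polynomial

section Series

lemma ConvergesOnDisc.exists_norm_mul_pow_le {u : PowerSeries k} (hu : ConvergesOnDisc u)
    {r : ℝ} (hr0 : 0 ≤ r) (hr1 : r < 1) :
    ∃ K, ∀ i, ‖u.coeff i‖ * r ^ i ≤ K := by
  obtain ⟨K, hK⟩ := (hu r hr0 hr1).bddAbove_range
  exact ⟨K, fun i => hK ⟨i, rfl⟩⟩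

lemma ConvergesOnDisc.tendsto_term {u : PowerSeries k} (hu : ConvergesOnDisc u) {x : k}
    (hx : ‖x‖ < 1) : Tendsto (fun i => u.coeff i * x ^ i) atTop (𝓝 0) := by
  rw [tendsto_zero_iff_norm_tendsto_zero]
  simpa using hu ‖x‖ (norm_nonneg x) hx

/-- A power series whose terms tend to zero on circles of radius arbitrarily close to `1`
converges on the open unit disc. -/
lemma convergesOnDisc_of_forall_exists {u : PowerSeries k}
    (h : ∀ r : ℝ, 0 ≤ r → r < 1 → ∃ s, r ≤ s ∧
      Tendsto (fun i => ‖u.coeff i‖ * s ^ i) atTop (𝓝 0)) : ConvergesOnDisc u := by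
  intro r hr0 hr1
  obtain ⟨s, hrs, hs⟩ := h r hr0 hr1
  exact squeeze_zero (fun i => by positivity) (fun i => by gcongr) hs

lemma discEval_zero (u : PowerSeries k) : discEval u 0 = u.coeff 0 := by
  rw [discEval, tsum_eq_single 0 fun i hi => by simp [hi]]
  simp

lemma ConvergesOnDisc.X_sub_C_mul {u : PowerSeries k} (hu : ConvergesOnDisc u) (b : k) :
    ConvergesOnDisc ((PowerSeries.X - PowerSeries.C b) * u) := by
  intro r hr0 hr1
  have h1 : Tendsto (fun i => r * (‖u.coeff i‖ * r ^ i) + ‖b‖ * (‖u.coeff (i + 1)‖ * r ^ (i + 1)))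
      atTop (𝓝 0) := by
    simpa using ((hu r hr0 hr1).const_mul r).add
      (((tendsto_add_atTop_iff_nat 1).2 (hu r hr0 hr1)).const_mul ‖b‖)
  rw [← tendsto_add_atTop_iff_nat 1]
  refine squeeze_zero (fun i => by positivity) (fun i => ?_) h1
  rw [sub_mul, map_sub, PowerSeries.coeff_succ_X_mul, PowerSeries.coeff_C_mul]
  calc _ ≤ (‖u.coeff i‖ + ‖b * u.coeff (i + 1)‖) * r ^ (i + 1) := by
        gcongr; exact norm_sub_le _ _
    _ = _ := by rw [norm_mul]; ring

variable [IsUltrametricDist k]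

section Complete

variable [CompleteSpace k]

lemma ConvergesOnDisc.hasSum {u : PowerSeries k} (hu : ConvergesOnDisc u) {x : k}
    (hx : ‖x‖ < 1) : HasSum (fun i => u.coeff i * x ^ i) (discEval u x) := by
  refine (NonarchimedeanAddGroup.summable_of_tendsto_cofinite_zero ?_).hasSum
  rw [Nat.cofinite_eq_atTop]
  exact hu.tendsto_term hx

lemma ConvergesOnDisc.norm_discEval_sub_le {u : PowerSeries k} (hu : ConvergesOnDisc u)
    {r K : ℝ} (hr0 : 0 < r) (hr1 : r < 1) (hK : ∀ i, ‖u.coeff i‖ * r ^ i ≤ K) {x y : k}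
    (hx : ‖x‖ ≤ r) (hy : ‖y‖ ≤ r) :
    ‖discEval u x - discEval u y‖ ≤ K / r * ‖x - y‖ := by
  have hs := (hu.hasSum (hx.trans_lt hr1)).sub (hu.hasSum (hy.trans_lt hr1))
  have hK0 : 0 ≤ K := le_trans (by positivity) (hK 0)
  rw [← hs.tsum_eq]
  refine IsUltrametricDist.norm_tsum_le_of_forall_le_of_nonneg (by positivity) fun i => ?_
  rw [← mul_sub, norm_mul]
  cases i with
  | zero => simp; positivity
  | succ i =>
    have h1 : ‖x ^ (i + 1) - y ^ (i + 1)‖ ≤ r ^ i * ‖x - y‖ := by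
      rw [← (Commute.all x y).geom_sum₂_mul, norm_mul]
      refine mul_le_mul_of_nonneg_right ?_ (norm_nonneg _)
      refine IsUltrametricDist.norm_sum_le_of_forall_le_of_nonneg (by positivity) fun j hj => ?_
      have hj' : j + (i + 1 - 1 - j) = i := by have := Finset.mem_range.1 hj; omega
      rw [norm_mul, norm_pow, norm_pow]
      calc ‖x‖ ^ j * ‖y‖ ^ (i + 1 - 1 - j) ≤ r ^ j * r ^ (i + 1 - 1 - j) := by gcongr
        _ = r ^ i := by rw [← pow_add, hj']
    have h2 : ‖u.coeff (i + 1)‖ * r ^ i ≤ K / r := by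
      rw [le_div_iff₀ hr0, mul_assoc, ← pow_succ]
      exact hK (i + 1)
    calc _ ≤ ‖u.coeff (i + 1)‖ * (r ^ i * ‖x - y‖) := by gcongr
      _ = ‖u.coeff (i + 1)‖ * r ^ i * ‖x - y‖ := by ring
      _ ≤ _ := by gcongr

lemma ConvergesOnDisc.continuousAt_discEval {u : PowerSeries k} (hu : ConvergesOnDisc u)
    {x : k} (hx : ‖x‖ < 1) : ContinuousAt (discEval u) x := by
  obtain ⟨r, hxr, hr1⟩ := exists_between hx
  have hr0 : 0 < r := (norm_nonneg x).trans_lt hxr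
  obtain ⟨K, hK⟩ := hu.exists_norm_mul_pow_le hr0.le hr1
  rw [ContinuousAt, tendsto_iff_norm_sub_tendsto_zero]
  have hlim : Tendsto (fun y => K / r * ‖y - x‖) (𝓝 x) (𝓝 0) := by
    have : ContinuousAt (fun y => K / r * ‖y - x‖) x := by fun_prop
    simpa [ContinuousAt] using this
  refine squeeze_zero' (Eventually.of_forall fun y => norm_nonneg _) ?_ hlim
  filter_upwards [continuous_norm.continuousAt.eventually_lt_const hxr] with y hy
  exact hu.norm_discEval_sub_le hr0 hr1 hK hy.le hxr.le

/-- A zero of a convergent power series splits off a linear factor. -/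
lemma ConvergesOnDisc.exists_eq_X_sub_C_mul {c : PowerSeries k} (hc : ConvergesOnDisc c)
    {b : k} (hb : ‖b‖ < 1) (h0 : discEval c b = 0) :
    ∃ u, ConvergesOnDisc u ∧ c = (PowerSeries.X - PowerSeries.C b) * u := by
  have hsum : ∀ n, Summable fun j => c.coeff (j + n) * b ^ j := by
    intro n
    rcases eq_or_ne b 0 with rfl | hb0
    · exact summable_of_ne_finset_zero (s := {0}) fun j hj => by
        simp [show j ≠ 0 by simpa using hj]
    · have h1 := ((summable_nat_add_iff n).2 (hc.hasSum hb).summable).mul_right ((b ^ n)⁻¹)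
      refine h1.congr fun j => ?_
      rw [pow_add]
      field_simp
  refine ⟨PowerSeries.mk fun i => ∑' j, c.coeff (j + (i + 1)) * b ^ j, ?_, ?_⟩
  · refine convergesOnDisc_of_forall_exists fun r hr0 hr1 => ?_
    obtain ⟨s, hs, hs1⟩ := exists_between (max_lt hr1 hb)
    have hs0 : 0 < s := hr0.trans_lt ((le_max_left _ _).trans_lt hs)
    have hbs : ‖b‖ ≤ s := ((le_max_right _ _).trans_lt hs).le
    refine ⟨s, ((le_max_left _ _).trans_lt hs).le, ?_⟩
    rw [Metric.tendsto_atTop]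
    intro ε hε
    obtain ⟨n, hn⟩ := Metric.tendsto_atTop.1 (hc s hs0.le hs1) (ε / 2 * s) (by positivity)
    refine ⟨n, fun i hi => ?_⟩
    rw [PowerSeries.coeff_mk, Real.dist_0_eq_abs, abs_of_nonneg (by positivity)]
    have hle : ‖∑' j, c.coeff (j + (i + 1)) * b ^ j‖ ≤ ε / 2 / s ^ i := by
      refine IsUltrametricDist.norm_tsum_le_of_forall_le_of_nonneg (by positivity) fun j => ?_
      have h1 := hn (j + (i + 1)) (by omega)
      rw [Real.dist_0_eq_abs, abs_of_nonneg (by positivity)] at h1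
      rw [norm_mul, norm_pow, le_div_iff₀ (by positivity)]
      refine le_of_mul_le_mul_right ?_ hs0
      calc _ ≤ ‖c.coeff (j + (i + 1))‖ * s ^ j * s ^ i * s := by gcongr
        _ = ‖c.coeff (j + (i + 1))‖ * s ^ (j + (i + 1)) := by ring
        _ ≤ _ := h1.le
    calc _ ≤ ε / 2 / s ^ i * s ^ i := by gcongr
      _ = ε / 2 := by field_simp
      _ < ε := by linarith
  · ext i
    cases i with
    | zero =>
      have h1 := (hsum 0).tsum_eq_zero_add
      have h2 : ∑' j, c.coeff (j + 1) * b ^ (j + 1) = b * ∑' j, c.coeff (j + 1) * b ^ j := by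
        rw [← tsum_mul_left]
        exact tsum_congr fun j => by ring
      simp only [discEval] at h0
      simp only [add_zero, pow_zero, mul_one, h0, h2] at h1
      simp only [sub_mul, map_sub, PowerSeries.coeff_zero_X_mul, PowerSeries.coeff_C_mul,
        PowerSeries.coeff_mk, zero_add]
      linear_combination -h1
    | succ i =>
      have h1 := (hsum (i + 1)).tsum_eq_zero_add
      have h2 : ∑' j, c.coeff (j + 1 + (i + 1)) * b ^ (j + 1) =
          b * ∑' j, c.coeff (j + (i + 1 + 1)) * b ^ j := by
        rw [← tsum_mul_left]
        exact tsum_congr fun j => by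
          rw [show j + 1 + (i + 1) = j + (i + 1 + 1) by ring]; ring
      simp only [zero_add, pow_zero, mul_one, h2] at h1
      simp only [sub_mul, map_sub, PowerSeries.coeff_succ_X_mul, PowerSeries.coeff_C_mul,
        PowerSeries.coeff_mk]
      linear_combination -h1

lemma ConvergesOnDisc.discEval_X_sub_C_mul {u : PowerSeries k} (hu : ConvergesOnDisc u)
    (b : k) {x : k} (hx : ‖x‖ < 1) :
    discEval ((PowerSeries.X - PowerSeries.C b) * u) x = (x - b) * discEval u x := by
  have hs := hu.hasSum hx
  have h1 : HasSum (fun i => (PowerSeries.X * u).coeff i * x ^ i) (x * discEval u x) := by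
    rw [← hasSum_nat_add_iff' 1]
    simpa [pow_succ, mul_comm, mul_left_comm, mul_assoc] using hs.mul_left x
  have h2 : HasSum (fun i => (PowerSeries.C b * u).coeff i * x ^ i) (b * discEval u x) := by
    simpa [mul_assoc] using hs.mul_left b
  rw [sub_mul (x : k), ← (h1.sub h2).tsum_eq, discEval]
  exact tsum_congr fun i => by rw [sub_mul, map_sub, sub_mul]

end Complete

lemma StrictlyDominant.X_sub_C_mul {u : PowerSeries k} {r : ℝ} {n : ℕ} {b : k}
    (hu : StrictlyDominant u r n) (hun : u.coeff n ≠ 0) (hb : ‖b‖ < r) :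
    StrictlyDominant ((PowerSeries.X - PowerSeries.C b) * u) r (n + 1) ∧
      ((PowerSeries.X - PowerSeries.C b) * u).coeff (n + 1) ≠ 0 := by
  have hr : 0 < r := (norm_nonneg b).trans_lt hb
  have hpos : 0 < ‖u.coeff n‖ * r ^ n := by positivity
  have hle : ∀ i, ‖u.coeff i‖ * r ^ i ≤ ‖u.coeff n‖ * r ^ n := fun i => by
    rcases eq_or_ne i n with rfl | h
    exacts [le_rfl, (hu i h).le]
  have hbu : ∀ i, ‖b * u.coeff i‖ * r ^ i < ‖u.coeff n‖ * r ^ (n + 1) := fun i => by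
    calc _ = ‖b‖ * (‖u.coeff i‖ * r ^ i) := by rw [norm_mul]; ring
      _ ≤ ‖b‖ * (‖u.coeff n‖ * r ^ n) := mul_le_mul_of_nonneg_left (hle i) (norm_nonneg b)
      _ < r * (‖u.coeff n‖ * r ^ n) := by gcongr
      _ = _ := by ring
  have hlead : ‖((PowerSeries.X - PowerSeries.C b) * u).coeff (n + 1)‖ = ‖u.coeff n‖ := by
    rw [sub_mul, map_sub, PowerSeries.coeff_succ_X_mul, PowerSeries.coeff_C_mul]
    have h1 := lt_of_mul_lt_mul_right (hbu (n + 1)) (by positivity)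
    rw [← norm_neg (b * _)] at h1
    rw [sub_eq_add_neg, IsUltrametricDist.norm_add_eq_max_of_norm_ne_norm h1.ne']
    exact max_eq_left h1.le
  refine ⟨fun i hi => ?_, fun h => hun ?_⟩
  · rw [hlead]
    cases i with
    | zero => simpa [sub_mul] using hbu 0
    | succ i =>
      rw [sub_mul, map_sub, PowerSeries.coeff_succ_X_mul, PowerSeries.coeff_C_mul]
      have h1 : ‖u.coeff i - b * u.coeff (i + 1)‖ ≤ max ‖u.coeff i‖ ‖b * u.coeff (i + 1)‖ := by
        simpa [sub_eq_add_neg] using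
          IsUltrametricDist.norm_add_le_max (u.coeff i) (-(b * u.coeff (i + 1)))
      refine (mul_le_mul_of_nonneg_right h1 (by positivity)).trans_lt ?_
      rw [max_mul_of_nonneg _ _ (by positivity)]
      refine max_lt ?_ (hbu (i + 1))
      have h2 := hu i (by simpa using hi)
      rw [pow_succ, pow_succ, ← mul_assoc, ← mul_assoc]
      gcongr
  · rw [← norm_eq_zero, ← hlead, h, norm_zero]

/-- The dominant index of `∏ (X - b) * u` exceeds that of `u` by the number of factors. -/
lemma StrictlyDominant.prod_X_sub_C_mul {u : PowerSeries k} {r : ℝ} {n : ℕ}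
    (hu : StrictlyDominant u r n) (hun : u.coeff n ≠ 0) (s : Multiset k)
    (hs : ∀ b ∈ s, ‖b‖ < r) :
    StrictlyDominant ((s.map fun b => PowerSeries.X - PowerSeries.C b).prod * u) r
        (n + s.card) ∧
      ((s.map fun b => PowerSeries.X - PowerSeries.C b).prod * u).coeff (n + s.card) ≠ 0 := by
  induction s using Multiset.induction_on with
  | empty => simpa using ⟨hu, hun⟩
  | cons b s ih =>
    obtain ⟨h1, h2⟩ := ih fun w hw => hs w (Multiset.mem_cons_of_mem hw)
    rw [Multiset.map_cons, Multiset.prod_cons, mul_assoc, Multiset.card_cons, ← add_assoc]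
    exact h1.X_sub_C_mul h2 (hs b (Multiset.mem_cons_self b s))

lemma ConvergesOnDisc.prod_X_sub_C_mul [CompleteSpace k] {u : PowerSeries k}
    (hu : ConvergesOnDisc u) (s : Multiset k) :
    ConvergesOnDisc ((s.map fun b => PowerSeries.X - PowerSeries.C b).prod * u) ∧
      ∀ x : k, ‖x‖ < 1 →
        discEval ((s.map fun b => PowerSeries.X - PowerSeries.C b).prod * u) x =
          (s.map fun b => x - b).prod * discEval u x := by
  induction s using Multiset.induction_on with
  | empty => simpa using hu
  | cons b s ih =>
    obtain ⟨h1, h2⟩ := ih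
    simp only [Multiset.map_cons, Multiset.prod_cons, mul_assoc]
    refine ⟨h1.X_sub_C_mul b, fun x hx => ?_⟩
    rw [h1.discEval_X_sub_C_mul b hx, h2 x hx]

end Series

section Zeros

lemma eq_of_sub_pow_mul_eq {f g : k → k} {b : k} (hb : ‖b‖ < 1) (hf : ContinuousAt f b)
    (hg : ContinuousAt g b) (j : ℕ)
    (h : ∀ x, ‖x‖ < 1 → (x - b) ^ j * f x = (x - b) ^ j * g x) : f b = g b := by
  refine ((hf.eventuallyEq_nhds_iff_eventuallyEq_nhdsNE hg).1 ?_).eq_of_nhds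
  have h1 : ∀ᶠ x in 𝓝[≠] b, ‖x‖ < 1 :=
    nhdsWithin_le_nhds (continuous_norm.continuousAt.eventually_lt_const hb)
  filter_upwards [h1, self_mem_nhdsWithin] with x hx hxb
  exact mul_left_cancel₀ (pow_ne_zero j (sub_ne_zero.2 hxb)) (h x hx)

lemma continuous_prod_sub (s : Multiset k) : Continuous fun x : k => (s.map fun b => x - b).prod :=
  continuous_multiset_prod s fun _ _ => continuous_id.sub continuous_const

variable [IsUltrametricDist k] [CompleteSpace k]

/-- A convergent power series whose constant term is not strictly dominant has a zero. -/
lemma ConvergesOnDisc.exists_discEval_eq_zero [IsAlgClosed k] {u : PowerSeries k}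
    (hu : ConvergesOnDisc u) {r : ℝ} (hr0 : 0 < r) (hr1 : r < 1) {n : ℕ} (hn : 1 ≤ n)
    (hun : u.coeff n ≠ 0) (h : ‖u.coeff 0‖ ≤ ‖u.coeff n‖ * r ^ n) :
    ∃ x, ‖x‖ < 1 ∧ discEval u x = 0 := by
  classical
  have hlim := hu r hr0.le hr1
  have hA : 0 < ‖u.coeff n‖ * r ^ n := by positivity
  -- the last dominant index `N`
  obtain ⟨N, hN1, hN0, hNle, hNlt⟩ : ∃ N, 1 ≤ N ∧ u.coeff N ≠ 0 ∧
      ‖u.coeff 0‖ ≤ ‖u.coeff N‖ * r ^ N ∧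
      ∀ i, N < i → ‖u.coeff i‖ * r ^ i < ‖u.coeff N‖ * r ^ N := by
    obtain ⟨B, hB⟩ := eventually_atTop.1 (hlim.eventually_lt_const hA)
    have hnB : n ≤ B := by
      by_contra hcon
      exact lt_irrefl _ (hB n (by omega))
    set p : ℕ → Prop := fun i => ‖u.coeff n‖ * r ^ n ≤ ‖u.coeff i‖ * r ^ i
    have hspec : p (Nat.findGreatest p B) := Nat.findGreatest_spec hnB le_rfl
    refine ⟨Nat.findGreatest p B, hn.trans (Nat.le_findGreatest hnB le_rfl), fun h0 => ?_,
      h.trans hspec, fun i hi => lt_of_lt_of_le ?_ hspec⟩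
    · have h1 := hA.trans_le hspec
      rw [h0, norm_zero, zero_mul] at h1
      exact lt_irrefl _ h1
    · rcases le_total i B with hiB | hiB
      · exact not_le.1 (Nat.findGreatest_is_greatest hi hiB)
      · exact hB i hiB
  have hNpos : 0 < ‖u.coeff N‖ := norm_pos_iff.2 hN0
  have hcoeff : ∀ m, N ≤ m → ((PowerSeries.trunc (m + 1) u).coeff N) = u.coeff N := fun m hm => by
    rw [PowerSeries.coeff_trunc, if_pos (by omega)]
  -- a root of one truncation is close to a root of the next one
  have hstep : ∀ m, N ≤ m → ∀ x : k, ‖x‖ ≤ r → (PowerSeries.trunc (m + 1) u).eval x = 0 →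
      ∃ y, ‖y‖ ≤ r ∧ (PowerSeries.trunc (m + 2) u).eval y = 0 ∧
        ‖u.coeff N‖ * ‖y - x‖ ^ N ≤ ‖u.coeff (m + 1)‖ * r ^ (m + 1) := by
    intro m hm x hx hroot
    have hnorm : ‖(Polynomial.taylor x (PowerSeries.trunc (m + 2) u)).coeff N‖ = ‖u.coeff N‖ := by
      rw [norm_taylor_coeff_eq hr0 (N := N) _ _ _ hx, hcoeff (m + 1) (by omega)]
      · rwa [hcoeff (m + 1) (by omega)]
      · intro i hi
        rw [hcoeff (m + 1) (by omega), PowerSeries.coeff_trunc]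
        split_ifs
        · exact hNlt i hi
        · simpa using mul_pos hNpos (pow_pos hr0 N)
    obtain ⟨z, hz, hzle⟩ := exists_root_norm_pow_le
      (Polynomial.taylor x (PowerSeries.trunc (m + 2) u)) hN1
      (by rw [← norm_pos_iff, hnorm]; exact hNpos)
    rw [Polynomial.taylor_eval] at hz
    have hle : ‖u.coeff N‖ * ‖z‖ ^ N ≤ ‖u.coeff (m + 1)‖ * r ^ (m + 1) := by
      rw [← hnorm]
      refine hzle.trans ?_
      rw [Polynomial.taylor_coeff_zero, PowerSeries.trunc_succ, Polynomial.eval_add, hroot,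
        zero_add, Polynomial.eval_monomial, norm_mul, norm_pow]
      gcongr
    have hzr : ‖z‖ ≤ r := by
      have h1 : ‖z‖ ^ N < r ^ N :=
        lt_of_mul_lt_mul_left (hle.trans_lt (hNlt (m + 1) (by omega))) hNpos.le
      exact (lt_of_pow_lt_pow_left₀ N hr0.le h1).le
    refine ⟨z + x, (IsUltrametricDist.norm_add_le_max z x).trans (max_le hzr hx), hz, ?_⟩
    rwa [add_sub_cancel_right]
  obtain ⟨x₀, hx₀, hx₀le⟩ := exists_root_norm_pow_le (PowerSeries.trunc (N + 1) u) hN1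
    (by rwa [hcoeff N le_rfl])
  have hx₀r : ‖x₀‖ ≤ r := by
    rw [hcoeff N le_rfl, PowerSeries.coeff_trunc, if_pos (by omega)] at hx₀le
    exact le_of_pow_le_pow_left₀ (by omega) hr0.le
      (le_of_mul_le_mul_left (hx₀le.trans hNle) hNpos)
  choose! f hf using hstep
  set x : ℕ → k := fun j => Nat.rec x₀ (fun j y => f (N + j) y) j with hxdef
  have hxs : ∀ j, ‖x j‖ ≤ r ∧ (PowerSeries.trunc (N + j + 1) u).eval (x j) = 0 := by
    intro j
    induction j with
    | zero => exact ⟨hx₀r, hx₀⟩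
    | succ j ih =>
      have := hf (N + j) (by omega) (x j) ih.1 ih.2
      exact ⟨this.1, this.2.1⟩
  have hdiff : ∀ j, ‖u.coeff N‖ * ‖x (j + 1) - x j‖ ^ N ≤
      ‖u.coeff (N + j + 1)‖ * r ^ (N + j + 1) := fun j =>
    (hf (N + j) (by omega) (x j) (hxs j).1 (hxs j).2).2.2
  have htail : ∀ ε > 0, ∃ J, ∀ i, J ≤ i → ‖u.coeff i‖ * r ^ i < ε := fun ε hε =>
    eventually_atTop.1 (hlim.eventually_lt_const hε)
  have hcauchy : CauchySeq x := by
    refine NonarchimedeanAddGroup.cauchySeq_of_tendsto_sub_nhds_zero ?_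
    rw [tendsto_zero_iff_norm_tendsto_zero, Metric.tendsto_atTop]
    intro ε hε
    obtain ⟨J, hJ⟩ := htail (‖u.coeff N‖ * ε ^ N) (by positivity)
    refine ⟨J, fun j hj => ?_⟩
    rw [Real.dist_0_eq_abs, abs_of_nonneg (norm_nonneg _)]
    have h1 := (hdiff j).trans_lt (hJ (N + j + 1) (by omega))
    exact lt_of_pow_lt_pow_left₀ N hε.le (lt_of_mul_lt_mul_left h1 hNpos.le)
  obtain ⟨y, hy⟩ := cauchySeq_tendsto_of_complete hcauchy
  have hyr : ‖y‖ ≤ r := le_of_tendsto' hy.norm fun j => (hxs j).1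
  refine ⟨y, hyr.trans_lt hr1, ?_⟩
  have hlim1 : Tendsto (fun j => discEval u (x j)) atTop (𝓝 (discEval u y)) :=
    (hu.continuousAt_discEval (hyr.trans_lt hr1)).tendsto.comp hy
  refine tendsto_nhds_unique hlim1 ?_
  rw [tendsto_zero_iff_norm_tendsto_zero, Metric.tendsto_atTop]
  intro ε hε
  obtain ⟨J, hJ⟩ := htail (ε / 2) (by positivity)
  refine ⟨J, fun j hj => ?_⟩
  rw [Real.dist_0_eq_abs, abs_of_nonneg (norm_nonneg _)]
  have hsum := (hu.hasSum ((hxs j).1.trans_lt hr1)).summable.sum_add_tsum_nat_add (N + j + 1)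
  have heval : ∑ i ∈ Finset.range (N + j + 1), u.coeff i * x j ^ i = 0 := by
    rw [← (hxs j).2, Polynomial.eval_eq_sum_range' (PowerSeries.natDegree_trunc_lt u (N + j))]
    refine Finset.sum_congr rfl fun i hi => ?_
    rw [PowerSeries.coeff_trunc, if_pos (Finset.mem_range.1 hi)]
  rw [heval, zero_add] at hsum
  rw [discEval, ← hsum]
  refine lt_of_le_of_lt ?_ (half_lt_self hε)
  refine IsUltrametricDist.norm_tsum_le_of_forall_le_of_nonneg (by positivity) fun i => ?_
  rw [norm_mul, norm_pow]
  refine le_trans ?_ (hJ (i + (N + j + 1)) (by omega)).le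
  gcongr
  exact (hxs j).1

/-- Zeros of prescribed multiplicities split off a polynomial factor. -/
lemma ConvergesOnDisc.exists_eq_prod_mul {G : PowerSeries k} (hG : ConvergesOnDisc G)
    (m : k → ℕ) (t : Finset k) (ht : ∀ b ∈ t, ‖b‖ < 1)
    (hw : ∀ b ∈ t, ∃ w : k → k, ContinuousAt w b ∧
      ∀ x, ‖x‖ < 1 → discEval G x = (x - b) ^ m b * w x) :
    ∃ u, ConvergesOnDisc u ∧ G = ((∑ b ∈ t, Multiset.replicate (m b) b).map
      fun b => PowerSeries.X - PowerSeries.C b).prod * u := by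
  classical
  induction t using Finset.induction_on with
  | empty => exact ⟨G, hG, by simp⟩
  | insert b t hbt ih =>
    obtain ⟨u, hu, hGu⟩ := ih (fun c hc => ht c (Finset.mem_insert_of_mem hc))
      (fun c hc => hw c (Finset.mem_insert_of_mem hc))
    have hb := ht b (Finset.mem_insert_self b t)
    obtain ⟨w, hwc, hwG⟩ := hw b (Finset.mem_insert_self b t)
    set S := ∑ b ∈ t, Multiset.replicate (m b) b with hS
    have hbS : b ∉ S := by
      rw [hS, Multiset.mem_sum]
      rintro ⟨c, hc, hbc⟩
      exact hbt (Multiset.eq_of_mem_replicate hbc ▸ hc)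
    have key : ∀ j, j ≤ m b → ∃ v, ConvergesOnDisc v ∧
        G = ((Multiset.replicate j b + S).map
          fun b => PowerSeries.X - PowerSeries.C b).prod * v := by
      intro j
      induction j with
      | zero => exact fun _ => ⟨u, hu, by simpa using hGu⟩
      | succ j ihj =>
        intro hj
        obtain ⟨v, hv, hGv⟩ := ihj (by omega)
        have hv0 : discEval v b = 0 := by
          have h1 := eq_of_sub_pow_mul_eq
            (f := fun x => (S.map fun b => x - b).prod * discEval v x)
            (g := fun x => (x - b) ^ (m b - j) * w x) hb
            ((continuous_prod_sub S).continuousAt.mul (hv.continuousAt_discEval hb))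
            (by fun_prop) j fun x hx => by
              have h2 := hwG x hx
              rw [hGv, (hv.prod_X_sub_C_mul _).2 x hx, Multiset.map_add, Multiset.prod_add,
                Multiset.map_replicate, Multiset.prod_replicate] at h2
              rw [← mul_assoc, h2, ← mul_assoc, ← pow_add, Nat.add_sub_cancel' (by omega)]
          simp only [sub_self, zero_pow (show m b - j ≠ 0 by omega), zero_mul] at h1
          refine (mul_eq_zero.1 h1).resolve_left fun h3 => hbS ?_
          obtain ⟨c, hc, hbc⟩ := Multiset.mem_map.1 (Multiset.prod_eq_zero_iff.1 h3)
          rwa [sub_eq_zero.1 hbc]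
        obtain ⟨v', hv', hvv'⟩ := hv.exists_eq_X_sub_C_mul hb hv0
        refine ⟨v', hv', ?_⟩
        rw [hGv, hvv', Multiset.replicate_succ, Multiset.cons_add, Multiset.map_cons,
          Multiset.prod_cons]
        ring
    rw [Finset.sum_insert hbt]
    exact key (m b) le_rfl

/-- Near the boundary of the disc, the dominant index of a power series with finitely many
zeros is the number of zeros counted with multiplicities. -/
theorem ConvergesOnDisc.exists_strictlyDominant [IsAlgClosed k] {G : PowerSeries k}
    (hG : ConvergesOnDisc G) (m : k → ℕ) (t : Finset k) (ht : ∀ b ∈ t, ‖b‖ < 1)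
    (hzero : ∀ x, ‖x‖ < 1 → discEval G x = 0 → x ∈ t)
    (hw : ∀ b ∈ t, ∃ w : k → k, ContinuousAt w b ∧ w b ≠ 0 ∧
      ∀ x, ‖x‖ < 1 → discEval G x = (x - b) ^ m b * w x) :
    G.coeff (∑ b ∈ t, m b) ≠ 0 ∧ ∃ r₀ < 1, ∀ r, r₀ < r → r < 1 →
      StrictlyDominant G r (∑ b ∈ t, m b) := by
  classical
  obtain ⟨u, hu, hGu⟩ := hG.exists_eq_prod_mul m t ht fun b hb =>
    let ⟨w, h1, _, h2⟩ := hw b hb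
    ⟨w, h1, h2⟩
  set S := ∑ b ∈ t, Multiset.replicate (m b) b with hS
  have hGeval : ∀ x, ‖x‖ < 1 → discEval G x = (S.map fun b => x - b).prod * discEval u x := by
    intro x hx
    rw [hGu]
    exact (hu.prod_X_sub_C_mul S).2 x hx
  have hu0 : ∀ x, ‖x‖ < 1 → discEval u x ≠ 0 := by
    intro x hx h0
    have hxt : x ∈ t := hzero x hx (by rw [hGeval x hx, h0, mul_zero])
    obtain ⟨w, hwc, hwx, hwG⟩ := hw x hxt
    have hsplit : S = Multiset.replicate (m x) x +
        ∑ b ∈ t.erase x, Multiset.replicate (m b) b :=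
      (Finset.add_sum_erase t _ hxt).symm
    have h1 := eq_of_sub_pow_mul_eq
      (f := fun y => ((∑ b ∈ t.erase x, Multiset.replicate (m b) b).map
        fun b => y - b).prod * discEval u y) (g := w) hx
      ((continuous_prod_sub _).continuousAt.mul (hu.continuousAt_discEval hx)) hwc (m x)
      fun y hy => by
        rw [← hwG y hy, hGeval y hy, hsplit, Multiset.map_add, Multiset.prod_add,
          Multiset.map_replicate, Multiset.prod_replicate, mul_assoc]
    exact hwx (by rw [← h1, h0, mul_zero])
  have hu00 : u.coeff 0 ≠ 0 := by
    rw [← discEval_zero]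
    exact hu0 0 (by simp)
  have hudom : ∀ r, 0 < r → r < 1 → StrictlyDominant u r 0 := by
    intro r hr0 hr1 i hi
    rw [pow_zero, mul_one]
    by_contra hcon
    rw [not_lt] at hcon
    have hui : u.coeff i ≠ 0 := fun h => hu00 (by simpa [h] using hcon)
    obtain ⟨x, hx, hx0⟩ := hu.exists_discEval_eq_zero hr0 hr1 (by omega) hui hcon
    exact hu0 x hx hx0
  have hcard : S.card = ∑ b ∈ t, m b := by simp [hS]
  have hmem : ∀ b ∈ S, b ∈ t := by
    intro b hb
    obtain ⟨c, hc, hbc⟩ := Multiset.mem_sum.1 hb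
    exact Multiset.eq_of_mem_replicate hbc ▸ hc
  obtain ⟨r₀, hr₀0, hr₀1, hr₀⟩ : ∃ r₀ : ℝ, 0 < r₀ ∧ r₀ < 1 ∧ ∀ b ∈ t, ‖b‖ ≤ r₀ := by
    obtain ⟨c, hc, hmax⟩ := (insert 0 t).exists_max_image (fun b => ‖b‖)
      ⟨0, Finset.mem_insert_self 0 t⟩
    have hc1 : ‖c‖ < 1 := by
      rcases Finset.mem_insert.1 hc with rfl | hc
      exacts [by simp, ht c hc]
    obtain ⟨r₀, h2, h3⟩ := exists_between hc1
    exact ⟨r₀, (norm_nonneg c).trans_lt h2, h3,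
      fun b hb => (hmax b (Finset.mem_insert_of_mem hb)).trans h2.le⟩
  have hmain : ∀ r, r₀ < r → r < 1 →
      StrictlyDominant G r (∑ b ∈ t, m b) ∧ G.coeff (∑ b ∈ t, m b) ≠ 0 := by
    intro r hr hr1
    have h1 := (hudom r (hr₀0.trans hr) hr1).prod_X_sub_C_mul hu00 S
      fun b hb => (hr₀ b (hmem b hb)).trans_lt hr
    rwa [← hGu, hcard, zero_add] at h1
  obtain ⟨r, hr, hr1⟩ := exists_between hr₀1
  exact ⟨(hmain r hr hr1).2, r₀, hr₀1, fun r hr hr1 => (hmain r hr hr1).1⟩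

end Zeros

section Slopes

lemma exists_lt_norm_lt_one [IsAlgClosed k] {r : ℝ} (hr1 : r < 1) :
    ∃ x : k, r < ‖x‖ ∧ ‖x‖ < 1 := by
  obtain ⟨y, hy0, hy1⟩ := NormedField.exists_norm_lt_one k
  obtain ⟨n, hn⟩ := exists_pow_lt_of_lt_one hy0 hr1
  have hn0 : n ≠ 0 := by
    rintro rfl
    rw [pow_zero] at hn
    exact lt_asymm hn hy1
  obtain ⟨x, hx⟩ := IsAlgClosed.exists_pow_nat_eq y (Nat.pos_of_ne_zero hn0)
  have hxn : ‖x‖ ^ n = ‖y‖ := by rw [← norm_pow, hx]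
  refine ⟨x, lt_of_pow_lt_pow_left₀ n (norm_nonneg x) (hxn ▸ hn), ?_⟩
  exact (pow_lt_one_iff_of_nonneg (norm_nonneg x) hn0).1 (hxn ▸ hy1)

lemma ConvergesOnDisc.mk_add {c : ℕ → k} (hc : ConvergesOnDisc (PowerSeries.mk c)) (m : ℕ) :
    ConvergesOnDisc (PowerSeries.mk fun i => c (i + m)) := by
  refine convergesOnDisc_of_forall_exists fun r hr0 hr1 => ?_
  obtain ⟨s, hrs, hs1⟩ := exists_between hr1
  have hs0 : 0 < s := hr0.trans_lt hrs
  refine ⟨s, hrs.le, ?_⟩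
  have h1 := ((tendsto_add_atTop_iff_nat m).2 (hc s hs0.le hs1)).mul_const ((s ^ m)⁻¹)
  rw [zero_mul] at h1
  refine h1.congr fun i => ?_
  rw [PowerSeries.coeff_mk, PowerSeries.coeff_mk, pow_add]
  field_simp

namespace DiscMorphism

variable (F : DiscMorphism k)

lemma coeff_mult_ne_zero (b : UnitDisc k) : F.coeff b (F.mult b) ≠ 0 :=
  (Nat.sInf_mem (F.coeff_nonconst b)).2

lemma coeff_eq_zero_of_lt_mult (b : UnitDisc k) {i : ℕ} (hi : i < F.mult b) :
    F.coeff b i = 0 := by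
  rcases Nat.eq_zero_or_pos i with rfl | h
  · exact F.coeff_zero b
  · by_contra hne
    exact Nat.notMem_of_lt_sInf hi ⟨h, hne⟩

variable [IsUltrametricDist k]

lemma convergesOnDisc [IsAlgClosed k] (a : UnitDisc k) :
    ConvergesOnDisc (PowerSeries.mk (F.coeff a)) := by
  refine convergesOnDisc_of_forall_exists fun r _ hr1 => ?_
  obtain ⟨x, hrx, hx1⟩ := exists_lt_norm_lt_one (k := k) hr1
  refine ⟨‖x‖, hrx.le, ?_⟩
  have hb : ‖x + a‖ < 1 := (IsUltrametricDist.norm_add_le_max x a).trans_lt (max_lt hx1 a.2)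
  have h1 := (F.expansion a ⟨x + a, hb⟩).summable.tendsto_atTop_zero.norm
  simpa using h1

lemma discEval_eq (a b : UnitDisc k) :
    discEval (PowerSeries.mk (F.coeff a)) (b - a) = (F.toFun b : k) - F.toFun a := by
  simpa [discEval] using (F.expansion a b).tsum_eq

/-- `f - f(b)` is divisible by `(x - b) ^ mult b` with cofactor nonvanishing at `b`. -/
lemma exists_cofactor [IsAlgClosed k] [CompleteSpace k] (b : UnitDisc k) :
    ∃ w : k → k, ContinuousAt w 0 ∧ w 0 ≠ 0 ∧ ∀ x : UnitDisc k,
      (F.toFun x : k) - F.toFun b = ((x : k) - b) ^ F.mult b * w (x - b) := by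
  have hW := (F.convergesOnDisc b).mk_add (F.mult b)
  refine ⟨discEval (PowerSeries.mk fun i => F.coeff b (i + F.mult b)),
    hW.continuousAt_discEval (by simp), ?_, fun x => ?_⟩
  · rw [discEval_zero, PowerSeries.coeff_mk, zero_add]
    exact F.coeff_mult_ne_zero b
  · have h1 := (F.expansion b x).summable.sum_add_tsum_nat_add (F.mult b)
    rw [(F.expansion b x).tsum_eq, Finset.sum_eq_zero fun i hi => by
      rw [F.coeff_eq_zero_of_lt_mult b (Finset.mem_range.1 hi), zero_mul], zero_add] at h1
    rw [← h1, discEval, ← tsum_mul_left]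
    refine tsum_congr fun i => ?_
    rw [PowerSeries.coeff_mk]
    ring

/-- Near the boundary of the disc the term of index `deg f` is strictly dominant. -/
theorem exists_strictlyDominant_degree [IsAlgClosed k] [CompleteSpace k] (a : UnitDisc k) :
    F.coeff a F.degree ≠ 0 ∧ ∃ r₀ < 1, ∀ r, r₀ < r → r < 1 →
      StrictlyDominant (PowerSeries.mk (F.coeff a)) r F.degree := by
  classical
  obtain ⟨s, hs, hdeg⟩ := F.finite_fibers (F.toFun a)
  have hadd : ∀ x : k, ‖x‖ < 1 → ‖x + a‖ < 1 := fun x hx =>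
    (IsUltrametricDist.norm_add_le_max x a).trans_lt (max_lt hx a.2)
  have hsub : ∀ b : UnitDisc k, ‖(b : k) - a‖ < 1 := fun b => by
    have h1 := (IsUltrametricDist.norm_add_le_max (b : k) (-a)).trans_lt
      (max_lt b.2 (by rw [norm_neg]; exact a.2))
    rwa [← sub_eq_add_neg] at h1
  set m : k → ℕ := fun x => if h : ‖x + a‖ < 1 then F.mult ⟨x + a, h⟩ else 0 with hm
  have hmb : ∀ b : UnitDisc k, m (b - a) = F.mult b := fun b => by
    have h1 : ‖(b : k) - a + a‖ < 1 := by simpa using b.2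
    simp only [hm, dif_pos h1]
    congr 1
    exact Subtype.ext (sub_add_cancel _ _)
  set t : Finset k := s.image fun b : UnitDisc k => (b : k) - a with ht
  have hsum : ∑ x ∈ t, m x = F.degree := by
    rw [ht, Finset.sum_image fun b _ c _ h => Subtype.ext (sub_left_injective h), ← hdeg]
    exact Finset.sum_congr rfl fun b _ => hmb b
  have heval : ∀ x (hx : ‖x‖ < 1), discEval (PowerSeries.mk (F.coeff a)) x =
      (F.toFun ⟨x + a, hadd x hx⟩ : k) - F.toFun a := fun x hx => by
    have h1 := F.discEval_eq a ⟨x + a, hadd x hx⟩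
    simpa only [add_sub_cancel_right] using h1
  have key := (F.convergesOnDisc a).exists_strictlyDominant m t
    (by
      intro x hx
      obtain ⟨b, -, rfl⟩ := Finset.mem_image.1 hx
      exact hsub b)
    (by
      intro x hx h0
      rw [heval x hx, sub_eq_zero] at h0
      exact Finset.mem_image.2 ⟨⟨x + a, hadd x hx⟩, (hs _).1 (Subtype.ext h0),
        add_sub_cancel_right _ _⟩)
    (by
      intro x hx
      obtain ⟨b, hb, rfl⟩ := Finset.mem_image.1 hx
      obtain ⟨w, hwc, hw0, hwe⟩ := F.exists_cofactor b
      refine ⟨fun y => w (y - (b - a)), ?_, by simpa using hw0, fun y hy => ?_⟩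
      · refine ContinuousAt.comp (g := w) ?_ (by fun_prop)
        simpa using hwc
      · have h1 := hwe ⟨y + a, hadd y hy⟩
        rw [(hs b).2 hb] at h1
        rw [heval y hy, h1, hmb, show y + (a : k) - b = y - (b - a) by ring])
  rw [hsum] at key
  simpa using key

end DiscMorphism

end Slopes

section PolygonSlopes

namespace DiscMorphism

variable (F : DiscMorphism k) {a : UnitDisc k} {d : ℕ}

lemma bddBelow_vpol_set (hle : ∀ i, ‖F.coeff a i‖ ≤ ‖F.coeff a d‖) {lam : ℝ} (hlam : 0 ≤ lam) :
    BddBelow {t : ℝ | ∃ i : ℕ, F.coeff a i ≠ 0 ∧ t = -Real.log ‖F.coeff a i‖ + i * lam} := by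
  refine ⟨-Real.log ‖F.coeff a d‖, ?_⟩
  rintro t ⟨i, hi, rfl⟩
  have h1 := Real.log_le_log (norm_pos_iff.2 hi) (hle i)
  have h2 : 0 ≤ (i : ℝ) * lam := by positivity
  linarith

/-- If `f^{[d]}(a)` has maximal norm, then no slope of the valuation polygon exceeds `d`. -/
lemma vpol_le_add (hd : F.coeff a d ≠ 0) (hle : ∀ i, ‖F.coeff a i‖ ≤ ‖F.coeff a d‖)
    {x y : ℝ} (hx : 0 < x) (hxy : x ≤ y) : F.vpol a y ≤ F.vpol a x + d * (y - x) := by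
  rw [← sub_le_iff_le_add]
  refine le_csInf ⟨_, d, hd, rfl⟩ ?_
  rintro t ⟨i, hi, rfl⟩
  rw [sub_le_iff_le_add]
  have hbdd := F.bddBelow_vpol_set hle (hx.le.trans hxy)
  rcases le_total i d with hid | hid
  · refine (csInf_le hbdd ⟨i, hi, rfl⟩).trans ?_
    have : (i : ℝ) * (y - x) ≤ d * (y - x) := by
      have : (i : ℝ) ≤ d := by exact_mod_cast hid
      gcongr
    linarith
  · refine (csInf_le hbdd ⟨d, hd, rfl⟩).trans ?_
    have h1 := Real.log_le_log (norm_pos_iff.2 hi) (hle i)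
    have h2 : (d : ℝ) * x ≤ i * x := by gcongr
    linarith

lemma rightSlope_vpol_le (hd : F.coeff a d ≠ 0) (hle : ∀ i, ‖F.coeff a i‖ ≤ ‖F.coeff a d‖)
    {x : ℝ} (hx : 0 < x) : rightSlope (F.vpol a) x ≤ d := by
  by_cases hdiff : DifferentiableWithinAt ℝ (F.vpol a) (Ioi x) x
  · have h1 := (hasDerivWithinAt_iff_tendsto_slope' self_notMem_Ioi).1 hdiff.hasDerivWithinAt
    refine le_of_tendsto h1 ?_
    filter_upwards [self_mem_nhdsWithin] with y hy
    have hy' : 0 < y - x := sub_pos.2 hy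
    rw [slope_def_field, div_le_iff₀ hy']
    have := F.vpol_le_add hd hle hx (le_of_lt hy)
    linarith
  · rw [rightSlope, derivWithin_zero_of_not_differentiableWithinAt hdiff]
    exact Nat.cast_nonneg d

lemma vpol_eq_of_strictlyDominant (hd : F.coeff a d ≠ 0) {lam : ℝ}
    (h : StrictlyDominant (PowerSeries.mk (F.coeff a)) (Real.exp (-lam)) d) :
    F.vpol a lam = -Real.log ‖F.coeff a d‖ + d * lam := by
  refine IsLeast.csInf_eq ⟨⟨d, hd, rfl⟩, ?_⟩
  rintro t ⟨i, hi, rfl⟩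
  have hlog : ∀ j, F.coeff a j ≠ 0 →
      Real.log (‖F.coeff a j‖ * Real.exp (-lam) ^ j) = Real.log ‖F.coeff a j‖ - j * lam := by
    intro j hj
    rw [Real.log_mul (norm_ne_zero_iff.2 hj) (by positivity), Real.log_pow, Real.log_exp]
    ring
  rcases eq_or_ne i d with rfl | hne
  · exact le_rfl
  · have h1 := h i hne
    simp only [PowerSeries.coeff_mk] at h1
    have h2 := Real.log_lt_log (by positivity) h1
    rw [hlog i hi, hlog d hd] at h2
    linarith

/-- If the term of index `d` is strictly dominant near the boundary of the disc, then `d` is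
the greatest slope of the valuation polygon. -/
theorem isGreatest_slopesOn_vpol (hd : F.coeff a d ≠ 0) {r₀ : ℝ} (hr₀ : r₀ < 1)
    (h : ∀ r, r₀ < r → r < 1 → StrictlyDominant (PowerSeries.mk (F.coeff a)) r d) :
    IsGreatest (slopesOn (F.vpol a) (Ioi 0)) (d : ℝ) := by
  have hle : ∀ i, ‖F.coeff a i‖ ≤ ‖F.coeff a d‖ := by
    intro i
    rcases eq_or_ne i d with rfl | hne
    · exact le_rfl
    have hlim : ∀ j, Tendsto (fun r : ℝ => ‖F.coeff a j‖ * r ^ j) (𝓝[<] 1)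
        (𝓝 ‖F.coeff a j‖) := by
      intro j
      have : ContinuousAt (fun r : ℝ => ‖F.coeff a j‖ * r ^ j) 1 := by fun_prop
      simpa [ContinuousAt] using this.tendsto.mono_left (nhdsWithin_le_nhds (s := Iio 1))
    refine le_of_tendsto_of_tendsto (hlim i) (hlim d) ?_
    filter_upwards [Ioo_mem_nhdsLT hr₀] with r hr
    simpa using (h r hr.1 hr.2 i hne).le
  have hexp : ∀ᶠ lam : ℝ in 𝓝[>] 0, r₀ < Real.exp (-lam) := by
    have : ContinuousAt (fun lam : ℝ => Real.exp (-lam)) 0 := by fun_prop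
    exact nhdsWithin_le_nhds (this.eventually_const_lt (by simpa using hr₀))
  have hvpol : ∀ᶠ lam in 𝓝[>] (0 : ℝ), F.vpol a lam = -Real.log ‖F.coeff a d‖ + d * lam := by
    filter_upwards [hexp, self_mem_nhdsWithin] with lam h1 h2
    exact F.vpol_eq_of_strictlyDominant hd (h _ h1 (by simpa using h2))
  refine ⟨?_, ?_⟩
  · obtain ⟨ε, hε, hεs⟩ := (mem_nhdsGT_iff_exists_Ioo_subset).1 hvpol
    rw [mem_Ioi] at hε
    refine ⟨ε / 2, half_pos hε, ?_⟩
    have hmem : Ioo 0 ε ∈ 𝓝 (ε / 2) := Ioo_mem_nhds (half_pos hε) (half_lt_self hε)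
    have heq : F.vpol a =ᶠ[𝓝 (ε / 2)] fun lam => -Real.log ‖F.coeff a d‖ + d * lam :=
      mem_of_superset hmem hεs
    have hder : HasDerivAt (fun lam : ℝ => -Real.log ‖F.coeff a d‖ + d * lam) d (ε / 2) := by
      simpa using ((hasDerivAt_id (ε / 2)).const_mul (d : ℝ)).const_add (-Real.log ‖F.coeff a d‖)
    exact (hder.congr_of_eventuallyEq heq).hasDerivWithinAt.derivWithin
      (uniqueDiffWithinAt_Ioi _)
  · rintro _ ⟨x, hx, rfl⟩
    exact F.rightSlope_vpol_le hd hle hx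

end DiscMorphism

end PolygonSlopes

variable {p : ℕ} [Fact p.Prime]
variable [NormedAlgebra ℚ_[p] k] [IsAlgClosed k] [CompleteSpace k]

/-- Lemma 2.10: every finite morphism `f : D₁ → D₂` of open unit discs is
weakly `1`-radial; more precisely, if `f` has degree `d` then, for every center `a ∈ D₁(k)`
(i.e. for every pair of compatible coordinates), the highest (first) slope of the valuation
polygon `v_a(f,·)` is equal to `d`. -/
theorem finite_disc_morphism_weakly_one_radial
    (hk : IsNonarchimedean fun x : k => ‖x‖)
    (F : DiscMorphism k) (d : ℕ) (hd : F.degree = d) :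
    F.WeaklyRadialWith 1 {d} ∧
      ∀ a : UnitDisc k, IsGreatest (slopesOn (F.vpol a) (Set.Ioi 0)) (d : ℝ) := by
  have : IsUltrametricDist k :=
    IsUltrametricDist.isUltrametricDist_of_isNonarchimedean_norm hk
  have hgreatest : ∀ a : UnitDisc k, IsGreatest (slopesOn (F.vpol a) (Set.Ioi 0)) (d : ℝ) := by
    intro a
    obtain ⟨h0, r₀, hr₀, hdom⟩ := F.exists_strictlyDominant_degree a
    rw [hd] at h0 hdom
    exact F.isGreatest_slopesOn_vpol h0 hr₀ hdom
  refine ⟨⟨Or.inl rfl, Finset.card_singleton d, fun a => ⟨?_, ?_⟩⟩, hgreatest⟩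
  · simpa using (hgreatest a).1
  · rintro x hx ⟨j, hj, hjx⟩
    rw [Finset.mem_singleton] at hj
    subst hj
    exact ⟨j, Finset.mem_singleton_self j, le_antisymm ((hgreatest a).2 hx) hjx⟩
end
end
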